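/- arXiv:1308.2136 — 4 statements merged into one kernel-verified Lean document; each statement's English description precedes it below -/
import Mathlib

section
/- Let f and ν be a frontal with unit normal near p as in the context, and suppose p is a 5/2-cuspidal edge of f: there exist open neighborhoods and C^∞ diffeomorphisms φ of a neighborhood of (0,0) in ℝ² onto a neighborhood of p, with φ(0,0) = p, and Φ of a neighborhood of f(p) in ℝ³ onto a neighborhood of (0,0,0), with Φ(f(p)) = (0,0,0), such that Φ(f(φ(u,v))) = (u, v², v⁵). Then both the mean curvature H and the Gaussian curvature K are bounded on the set of regular points of f in some neighborhood of p. -/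
open scoped RealInnerProductSpace
open Filter

noncomputable section

/-- Euclidean 3-space. -/
abbrev E3 : Type := EuclideanSpace ℝ (Fin 3)

/-- Partial derivative in the first (`u`) direction. -/
def pu {E : Type*} [NormedAddCommGroup E] [NormedSpace ℝ E] (f : ℝ × ℝ → E) (q : ℝ × ℝ) : E :=
  fderiv ℝ f q (1, 0)

/-- Partial derivative in the second (`v`) direction. -/
def pv {E : Type*} [NormedAddCommGroup E] [NormedSpace ℝ E] (f : ℝ × ℝ → E) (q : ℝ × ℝ) : E :=
  fderiv ℝ f q (0, 1)

/-- Determinant of three column vectors in `ℝ³`. -/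
def det3 (a b c : E3) : ℝ :=
  Matrix.det !![a 0, b 0, c 0; a 1, b 1, c 1; a 2, b 2, c 2]

/-- Cross product in `ℝ³`. -/
def cross3 (a b : E3) : E3 :=
  (WithLp.equiv 2 (Fin 3 → ℝ)).symm
    ![a 1 * b 2 - a 2 * b 1, a 2 * b 0 - a 0 * b 2, a 0 * b 1 - a 1 * b 0]

/-- Coefficients of the first fundamental form. -/
def Ec (f : ℝ × ℝ → E3) (q : ℝ × ℝ) : ℝ := ⟪pu f q, pu f q⟫
def Fc (f : ℝ × ℝ → E3) (q : ℝ × ℝ) : ℝ := ⟪pu f q, pv f q⟫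
def Gc (f : ℝ × ℝ → E3) (q : ℝ × ℝ) : ℝ := ⟪pv f q, pv f q⟫

/-- Coefficients of the second fundamental form. -/
def Lc (f ν : ℝ × ℝ → E3) (q : ℝ × ℝ) : ℝ := ⟪pu (pu f) q, ν q⟫
def Mc (f ν : ℝ × ℝ → E3) (q : ℝ × ℝ) : ℝ := ⟪pv (pu f) q, ν q⟫
def Nc (f ν : ℝ × ℝ → E3) (q : ℝ × ℝ) : ℝ := ⟪pv (pv f) q, ν q⟫

/-- The mean curvature `H = (E N − 2 F M + G L)/(2(E G − F²))`. -/
def meanCurv (f ν : ℝ × ℝ → E3) (q : ℝ × ℝ) : ℝ :=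
  (Ec f q * Nc f ν q - 2 * Fc f q * Mc f ν q + Gc f q * Lc f ν q) /
    (2 * (Ec f q * Gc f q - Fc f q ^ 2))

/-- The Gaussian curvature `K = (L N − M²)/(E G − F²)`. -/
def gaussCurv (f ν : ℝ × ℝ → E3) (q : ℝ × ℝ) : ℝ :=
  (Lc f ν q * Nc f ν q - Mc f ν q ^ 2) / (Ec f q * Gc f q - Fc f q ^ 2)

open Topology Asymptotics

section Calculus

variable {E : Type*} [NormedAddCommGroup E] [NormedSpace ℝ E]

lemma fderiv_apply_eq_pu_pv (f : ℝ × ℝ → E) (q X : ℝ × ℝ) :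
    fderiv ℝ f q X = X.1 • pu f q + X.2 • pv f q := by
  have h : X = X.1 • ((1, 0) : ℝ × ℝ) + X.2 • ((0, 1) : ℝ × ℝ) := by ext <;> simp
  conv_lhs => rw [h]
  rw [map_add, map_smul, map_smul, pu, pv]

lemma hasDerivAt_pu {f : ℝ × ℝ → E} {x : ℝ × ℝ} (hf : DifferentiableAt ℝ f x) :
    HasDerivAt (fun t => f (t, x.2)) (pu f x) x.1 :=
  HasFDerivAt.comp_hasDerivAt (l := f) (f := fun t : ℝ => (t, x.2)) x.1 hf.hasFDerivAt
    ((hasDerivAt_id _).prodMk (hasDerivAt_const _ _))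

lemma hasDerivAt_pv {f : ℝ × ℝ → E} {x : ℝ × ℝ} (hf : DifferentiableAt ℝ f x) :
    HasDerivAt (fun t => f (x.1, t)) (pv f x) x.2 :=
  HasFDerivAt.comp_hasDerivAt (l := f) (f := fun t : ℝ => (x.1, t)) x.2 hf.hasFDerivAt
    ((hasDerivAt_const _ _).prodMk (hasDerivAt_id _))

lemma differentiable_fderiv_apply {f : ℝ × ℝ → E} (hf : ContDiff ℝ (⊤ : ℕ∞) f) (X : ℝ × ℝ) :
    Differentiable ℝ fun q => fderiv ℝ f q X :=
  ((hf.fderiv_right (m := 1) (by norm_cast)).clm_apply contDiff_const).differentiable (by simp)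

lemma pv_pu_eq_pu_pv {f : ℝ × ℝ → E} (hf : ContDiff ℝ (⊤ : ℕ∞) f) (q : ℝ × ℝ) :
    pv (pu f) q = pu (pv f) q := by
  have hd : DifferentiableAt ℝ (fderiv ℝ f) q :=
    (hf.fderiv_right (m := 1) (by norm_cast)).differentiable (by simp) q
  have h (X Y : ℝ × ℝ) :
      fderiv ℝ (fun q => fderiv ℝ f q X) q Y = fderiv ℝ (fderiv ℝ f) q Y X := by
    rw [fderiv_clm_apply hd (differentiableAt_const _)]
    simp
  have hs : IsSymmSndFDerivAt ℝ f q :=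
    hf.contDiffAt.isSymmSndFDerivAt (by simp; norm_cast)
  exact (h _ _).trans ((hs _ _).trans (h _ _).symm)

lemma fderiv_injective_of_leftInverse {F : Type*} [NormedAddCommGroup F] [NormedSpace ℝ F]
    {φ : E → F} {ψ : F → E} {x : E} (hφ : DifferentiableAt ℝ φ x)
    (hψ : DifferentiableAt ℝ ψ (φ x)) (h : ∀ᶠ y in 𝓝 x, ψ (φ y) = y) :
    Function.Injective (fderiv ℝ φ x) := by
  have h1 : HasFDerivAt (ψ ∘ φ) (ContinuousLinearMap.id ℝ E) x :=
    (hasFDerivAt_id x).congr_of_eventuallyEq h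
  have h2 := h1.unique (hψ.hasFDerivAt.comp x hφ.hasFDerivAt)
  intro a b hab
  have := congrArg (fderiv ℝ ψ (φ x)) hab
  simpa [← ContinuousLinearMap.comp_apply, ← h2] using this

lemma det_ne_zero_of_injective {T : ℝ × ℝ →L[ℝ] ℝ × ℝ} (hT : Function.Injective T) :
    (T (1, 0)).1 * (T (0, 1)).2 - (T (0, 1)).1 * (T (1, 0)).2 ≠ 0 := by
  intro h
  have key (c d : ℝ) (h0 : c • T (1, 0) + d • T (0, 1) = 0) : c = 0 ∧ d = 0 := by
    have : T (c, d) = T 0 := by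
      rw [map_zero, ← h0, ← map_smul, ← map_smul, ← map_add]
      simp
    simpa using hT this
  have h1 := key (T (0, 1)).2 (-(T (1, 0)).2) (by ext <;> simp <;> linarith)
  have h2 := key (T (0, 1)).1 (-(T (1, 0)).1) (by ext <;> simp <;> linarith)
  have h3 : T (1, 0) = 0 := by
    ext
    · simpa using h2.2
    · simpa using h1.2
  simpa using key 1 0 (by simp [h3])

lemma isBigO_snd_of_contDiffAt {s : ℝ × ℝ → ℝ} (hs : ContDiffAt ℝ 1 s 0)
    (h0 : ∀ᶠ u in 𝓝 (0 : ℝ), s (u, 0) = 0) : s =O[𝓝 0] fun x => x.2 := by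
  obtain ⟨K, t, ht, hK⟩ := hs.exists_lipschitzOnWith
  have hc : Tendsto (fun x : ℝ × ℝ => (x.1, (0 : ℝ))) (𝓝 0) (𝓝 0) := by
    have : Continuous fun x : ℝ × ℝ => (x.1, (0 : ℝ)) := by fun_prop
    exact this.tendsto' _ _ rfl
  have hc1 : Tendsto (fun x : ℝ × ℝ => x.1) (𝓝 0) (𝓝 0) := continuous_fst.tendsto' _ _ rfl
  refine IsBigO.of_bound K ?_
  filter_upwards [ht, hc ht, hc1.eventually h0] with x hx hx' hx0
  have := hK.dist_le_mul x hx _ hx'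
  rw [hx0] at this
  simpa [Prod.dist_eq] using this

end Calculus

section SecondFundamentalForm

variable {f ν : ℝ × ℝ → E3}

lemma inner_fderiv_eq_neg {a : ℝ × ℝ → E3} (ha : Differentiable ℝ a) (hν : Differentiable ℝ ν)
    (h : ∀ q, ⟪ν q, a q⟫ = 0) (q X : ℝ × ℝ) :
    ⟪fderiv ℝ a q X, ν q⟫ = -⟪a q, fderiv ℝ ν q X⟫ := by
  have h1 : (fun q => ⟪a q, ν q⟫) = fun _ => (0 : ℝ) := by
    funext q
    rw [real_inner_comm, h]
  have h2 := fderiv_inner_apply ℝ (ha q) (hν q) X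
  rw [h1] at h2
  simp at h2
  linarith

/-- The Weingarten equations. -/
lemma weingarten (hf : ContDiff ℝ (⊤ : ℕ∞) f) (hν : ContDiff ℝ (⊤ : ℕ∞) ν)
    (hfν : ∀ q, ⟪ν q, pu f q⟫ = 0 ∧ ⟪ν q, pv f q⟫ = 0) (q : ℝ × ℝ) :
    Lc f ν q = -⟪pu f q, pu ν q⟫ ∧ Mc f ν q = -⟪pu f q, pv ν q⟫ ∧
      Mc f ν q = -⟪pv f q, pu ν q⟫ ∧ Nc f ν q = -⟪pv f q, pv ν q⟫ := by
  have hν' : Differentiable ℝ ν := hν.differentiable (by simp)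
  have hu := inner_fderiv_eq_neg (differentiable_fderiv_apply hf (1, 0)) hν' fun q => (hfν q).1
  have hv := inner_fderiv_eq_neg (differentiable_fderiv_apply hf (0, 1)) hν' fun q => (hfν q).2
  refine ⟨hu q _, hu q _, ?_, hv q _⟩
  rw [Mc, pv_pu_eq_pu_pv hf]
  exact hv q _

end SecondFundamentalForm

/-- The Gram determinant of two vectors. -/
def gram (a b : E3) : ℝ := ⟪a, a⟫ * ⟪b, b⟫ - ⟪a, b⟫ ^ 2

/-- The numerator of the Gaussian curvature, from the partial derivatives `a`, `b` of the surface
and `c`, `d` of its normal. -/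
def gaussNum (a b c d : E3) : ℝ := ⟪a, c⟫ * ⟪b, d⟫ - ⟪b, c⟫ ^ 2

/-- The numerator of the mean curvature, up to sign, from the partial derivatives `a`, `b` of the
surface and `c`, `d` of its normal. -/
def meanNum (a b c d : E3) : ℝ := ⟪a, a⟫ * ⟪b, d⟫ - 2 * ⟪a, b⟫ * ⟪b, c⟫ + ⟪b, b⟫ * ⟪a, c⟫

section LinearChange

variable (a b c d : E3) (α β γ δ : ℝ)

lemma gram_linear_change :
    gram (α • a + γ • b) (β • a + δ • b) = (α * δ - β * γ) ^ 2 * gram a b := by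
  simp only [gram, inner_add_left, inner_add_right, real_inner_smul_left, real_inner_smul_right,
    real_inner_comm a b]
  ring

lemma gaussNum_linear_change (h : ⟪a, d⟫ = ⟪b, c⟫) :
    gaussNum (α • a + γ • b) (β • a + δ • b) (α • c + γ • d) (β • c + δ • d) =
      (α * δ - β * γ) ^ 2 * gaussNum a b c d := by
  simp only [gaussNum, inner_add_left, inner_add_right, real_inner_smul_left,
    real_inner_smul_right, h]
  ring

lemma meanNum_linear_change (h : ⟪a, d⟫ = ⟪b, c⟫) :
    meanNum (α • a + γ • b) (β • a + δ • b) (α • c + γ • d) (β • c + δ • d) =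
      (α * δ - β * γ) ^ 2 * meanNum a b c d := by
  simp only [meanNum, inner_add_left, inner_add_right, real_inner_smul_left,
    real_inner_smul_right, h, real_inner_comm a b]
  ring

lemma gram_ne_zero (h : ∀ s t : ℝ, s • a = t • b → s = 0) (hb : b ≠ 0) : gram a b ≠ 0 := by
  intro h0
  have h1 : ⟪b, b⟫ • a - ⟪a, b⟫ • b = 0 := by
    rw [← inner_self_eq_zero (𝕜 := ℝ)]
    have : ⟪⟪b, b⟫ • a - ⟪a, b⟫ • b, ⟪b, b⟫ • a - ⟪a, b⟫ • b⟫ = ⟪b, b⟫ * gram a b := by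
      simp only [gram, inner_sub_left, inner_sub_right, real_inner_smul_left,
        real_inner_smul_right, real_inner_comm a b]
      ring
    rw [this, h0, mul_zero]
  exact hb (inner_self_eq_zero.1 (h _ _ (sub_eq_zero.1 h1)))

end LinearChange

/-- The standard `5/2`-cuspidal edge. -/
def cuspModel (x : ℝ × ℝ) : E3 :=
  x.1 • EuclideanSpace.single 0 1 + x.2 ^ 2 • EuclideanSpace.single 1 1 +
    x.2 ^ 5 • EuclideanSpace.single 2 1

/-- The `v`-derivative of the standard `5/2`-cuspidal edge, divided by `v`. -/
def cuspDir (x : ℝ × ℝ) : E3 :=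
  (2 : ℝ) • EuclideanSpace.single 1 1 + (5 * x.2 ^ 3) • EuclideanSpace.single 2 1

lemma cuspModel_eq (x : ℝ × ℝ) :
    (WithLp.equiv 2 (Fin 3 → ℝ)).symm ![x.1, x.2 ^ 2, x.2 ^ 5] = cuspModel x := by
  ext i
  fin_cases i <;> simp [cuspModel]

lemma contDiff_cuspModel {n : WithTop ℕ∞} : ContDiff ℝ n cuspModel := by
  unfold cuspModel
  fun_prop

lemma contDiff_cuspDir {n : WithTop ℕ∞} : ContDiff ℝ n cuspDir := by
  unfold cuspDir
  fun_prop

lemma hasDerivAt_cuspModel_fst (u v : ℝ) :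
    HasDerivAt (fun t => cuspModel (t, v)) (EuclideanSpace.single 0 1) u := by
  simpa [cuspModel, add_assoc] using
    ((hasDerivAt_id u).smul_const (EuclideanSpace.single (0 : Fin 3) (1 : ℝ))).add_const
      (v ^ 2 • EuclideanSpace.single 1 1 + v ^ 5 • EuclideanSpace.single 2 1)

lemma hasDerivAt_cuspModel_snd (u v : ℝ) :
    HasDerivAt (fun t => cuspModel (u, t)) (v • cuspDir (u, v)) v := by
  have := (((hasDerivAt_pow 2 v).smul_const (EuclideanSpace.single (1 : Fin 3) (1 : ℝ))).const_add
    (u • EuclideanSpace.single (0 : Fin 3) (1 : ℝ))).add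
      ((hasDerivAt_pow 5 v).smul_const (EuclideanSpace.single (2 : Fin 3) (1 : ℝ)))
  refine HasDerivAt.congr_deriv (f := fun t => cuspModel (u, t)) this ?_
  simp only [cuspDir, smul_add, smul_smul]
  congr 2 <;> norm_num <;> ring

lemma hasDerivAt_cuspDir_snd_zero (u : ℝ) :
    HasDerivAt (fun t => cuspDir (u, t)) 0 0 := by
  unfold cuspDir
  simpa using (((hasDerivAt_pow 3 (0 : ℝ)).const_mul 5).smul_const
    (EuclideanSpace.single (2 : Fin 3) (1 : ℝ))).const_add
      ((2 : ℝ) • EuclideanSpace.single (1 : Fin 3) (1 : ℝ))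

section CuspidalEdge

variable {U : Set (ℝ × ℝ)} {Ω : Set E3} {Ψ : E3 → E3} {g n : ℝ × ℝ → E3}

/-- The field spanning, together with `g_u`, the limiting tangent planes of `g = Ψ ∘ cuspModel`:
one has `g_v = v • cuspField`. -/
def cuspField (Ψ : E3 → E3) (x : ℝ × ℝ) : E3 := fderiv ℝ Ψ (cuspModel x) (cuspDir x)

lemma pu_comp_cuspModel (hΨ : DifferentiableOn ℝ Ψ Ω) (hΩ : IsOpen Ω) {x : ℝ × ℝ}
    (hx : cuspModel x ∈ Ω) :
    pu (fun x => Ψ (cuspModel x)) x =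
      fderiv ℝ Ψ (cuspModel x) (EuclideanSpace.single 0 1) := by
  have h1 := (hΨ.differentiableAt (hΩ.mem_nhds hx))
  have h2 : DifferentiableAt ℝ (fun x => Ψ (cuspModel x)) x :=
    h1.comp x (contDiff_cuspModel.differentiable one_ne_zero x)
  exact (hasDerivAt_pu h2).unique
    (h1.hasFDerivAt.comp_hasDerivAt x.1 (hasDerivAt_cuspModel_fst x.1 x.2))

lemma pv_comp_cuspModel (hΨ : DifferentiableOn ℝ Ψ Ω) (hΩ : IsOpen Ω) {x : ℝ × ℝ}
    (hx : cuspModel x ∈ Ω) :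
    pv (fun x => Ψ (cuspModel x)) x = x.2 • cuspField Ψ x := by
  have h1 := (hΨ.differentiableAt (hΩ.mem_nhds hx))
  have h2 : DifferentiableAt ℝ (fun x => Ψ (cuspModel x)) x :=
    h1.comp x (contDiff_cuspModel.differentiable one_ne_zero x)
  rw [(hasDerivAt_pv h2).unique
    (h1.hasFDerivAt.comp_hasDerivAt x.2 (hasDerivAt_cuspModel_snd x.1 x.2)), map_smul]
  rfl

lemma contDiffAt_fderiv_comp_cuspModel (hΨ : ContDiffOn ℝ (⊤ : ℕ∞) Ψ Ω) (hΩ : IsOpen Ω)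
    {x : ℝ × ℝ} (hx : cuspModel x ∈ Ω) :
    ContDiffAt ℝ 1 (fun x => fderiv ℝ Ψ (cuspModel x)) x :=
  ((hΨ.contDiffAt (hΩ.mem_nhds hx)).fderiv_right (m := 1) (by norm_cast)).comp x
    contDiff_cuspModel.contDiffAt

lemma contDiffAt_cuspField (hΨ : ContDiffOn ℝ (⊤ : ℕ∞) Ψ Ω) (hΩ : IsOpen Ω)
    {x : ℝ × ℝ} (hx : cuspModel x ∈ Ω) : ContDiffAt ℝ 1 (cuspField Ψ) x :=
  (contDiffAt_fderiv_comp_cuspModel hΨ hΩ hx).clm_apply contDiff_cuspDir.contDiffAt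

/-- Along the singular curve, `cuspField` is stationary in the `v`-direction. -/
lemma hasDerivAt_cuspField_snd_zero (hΨ : ContDiffOn ℝ (⊤ : ℕ∞) Ψ Ω) (hΩ : IsOpen Ω)
    {u : ℝ} (hx : cuspModel (u, 0) ∈ Ω) :
    HasDerivAt (fun t => cuspField Ψ (u, t)) 0 0 := by
  have h1 : DifferentiableAt ℝ (fderiv ℝ Ψ) (cuspModel (u, 0)) :=
    ((hΨ.contDiffAt (hΩ.mem_nhds hx)).fderiv_right (m := 1) (by norm_cast)).differentiableAt
      one_ne_zero
  have h2 : HasDerivAt (fun t => fderiv ℝ Ψ (cuspModel (u, t))) 0 0 := by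
    have := h1.hasFDerivAt.comp_hasDerivAt (0 : ℝ) (hasDerivAt_cuspModel_snd u 0)
    exact this.congr_deriv (by simp)
  exact (h2.clm_apply (hasDerivAt_cuspDir_snd_zero u)).congr_deriv (by simp)

lemma inner_cuspField_pv_normal_eq_zero (hU : IsOpen U) (hΨ : ContDiffOn ℝ (⊤ : ℕ∞) Ψ Ω)
    (hΩ : IsOpen Ω) (hUΩ : ∀ x ∈ U, cuspModel x ∈ Ω) (hn : ContDiffOn ℝ (⊤ : ℕ∞) n U)
    (hgn : ∀ x ∈ U, ⟪n x, x.2 • cuspField Ψ x⟫ = 0) {u : ℝ} (hu : (u, (0 : ℝ)) ∈ U) :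
    ⟪cuspField Ψ (u, 0), pv n (u, 0)⟫ = 0 := by
  have hn' := hasDerivAt_pv
    ((hn.contDiffAt (hU.mem_nhds hu)).differentiableAt (by simp) : DifferentiableAt ℝ n (u, 0))
  have hd := (hasDerivAt_cuspField_snd_zero hΨ hΩ (hUΩ _ hu)).inner ℝ hn'
  have hU' : ∀ᶠ t in 𝓝 (0 : ℝ), (u, t) ∈ U :=
    (by fun_prop : Continuous fun t : ℝ => (u, t)).continuousAt (hU.mem_nhds hu)
  have hz : ∀ᶠ t in 𝓝[≠] (0 : ℝ), ⟪cuspField Ψ (u, t), n (u, t)⟫ = 0 := by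
    filter_upwards [hU'.filter_mono nhdsWithin_le_nhds, self_mem_nhdsWithin] with t ht ht0
    have := hgn _ ht
    rw [real_inner_smul_right, real_inner_comm] at this
    exact (mul_eq_zero.1 this).resolve_left ht0
  have h0 : ⟪cuspField Ψ (u, 0), n (u, 0)⟫ = 0 :=
    tendsto_nhds_unique (hd.continuousAt.tendsto.mono_left nhdsWithin_le_nhds)
      (tendsto_const_nhds.congr' (hz.mono fun _ h => h.symm))
  have hz' : (fun t => ⟪cuspField Ψ (u, t), n (u, t)⟫) =ᶠ[𝓝 0] fun _ => (0 : ℝ) := by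
    filter_upwards [eventually_nhdsWithin_iff.1 hz] with t ht
    by_cases h : t = 0
    · rw [h, h0]
    · exact ht h
  simpa using hd.unique ((hasDerivAt_const (0 : ℝ) (0 : ℝ)).congr_of_eventuallyEq hz')

/-- In the coordinates adapted to the `5/2`-cuspidal edge, both curvature numerators are bounded by
the Gram determinant. -/
lemma isBigO_gram (hU : IsOpen U) (hU0 : (0, 0) ∈ U) (hΨ : ContDiffOn ℝ (⊤ : ℕ∞) Ψ Ω)
    (hΩ : IsOpen Ω) (hUΩ : ∀ x ∈ U, cuspModel x ∈ Ω) (hn : ContDiffOn ℝ (⊤ : ℕ∞) n U)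
    (hg : ∀ x ∈ U, g x = Ψ (cuspModel x)) (hgn : ∀ x ∈ U, ⟪n x, pv g x⟫ = 0)
    (hinj : Function.Injective (fderiv ℝ Ψ (cuspModel 0))) :
    ((fun x => gaussNum (pu g x) (pv g x) (pu n x) (pv n x)) =O[𝓝 0]
        fun x => gram (pu g x) (pv g x)) ∧
      ((fun x => meanNum (pu g x) (pv g x) (pu n x) (pv n x)) =O[𝓝 0]
        fun x => gram (pu g x) (pv g x)) := by
  have hΨd := hΨ.differentiableOn (by simp)
  have hgeq {x} (hx : x ∈ U) : g =ᶠ[𝓝 x] fun x => Ψ (cuspModel x) :=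
    (hU.eventually_mem hx).mono hg
  set a : ℝ × ℝ → E3 := fun x => fderiv ℝ Ψ (cuspModel x) (EuclideanSpace.single 0 1)
  set h : ℝ × ℝ → E3 := cuspField Ψ with hh
  have hpu {x} (hx : x ∈ U) : pu g x = a x := by
    rw [pu, (hgeq hx).fderiv_eq]
    exact pu_comp_cuspModel hΨd hΩ (hUΩ x hx)
  have hpv {x} (hx : x ∈ U) : pv g x = x.2 • h x := by
    rw [pv, (hgeq hx).fderiv_eq]
    exact pv_comp_cuspModel hΨd hΩ (hUΩ x hx)
  have hΩ0 : cuspModel 0 ∈ Ω := hUΩ _ hU0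
  have hU0' := hU.eventually_mem hU0
  have hac : ContinuousAt a 0 :=
    ((contDiffAt_fderiv_comp_cuspModel hΨ hΩ hΩ0).clm_apply contDiffAt_const).continuousAt
  have hhd : ContDiffAt ℝ 1 h 0 := contDiffAt_cuspField hΨ hΩ hΩ0
  have hhc := hhd.continuousAt
  have hn' : ContDiffAt ℝ 1 (fderiv ℝ n) 0 :=
    (hn.contDiffAt (hU.mem_nhds hU0)).fderiv_right (m := 1) (by norm_cast)
  have hnv : ContDiffAt ℝ 1 (pv n) 0 := hn'.clm_apply contDiffAt_const
  have hnu : ContinuousAt (pu n) 0 := (hn'.clm_apply contDiffAt_const).continuousAt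
  have hs : (fun x => ⟪h x, pv n x⟫) =O[𝓝 0] fun x : ℝ × ℝ => x.2 := by
    refine isBigO_snd_of_contDiffAt (hhd.inner ℝ hnv) ?_
    have : ∀ᶠ u in 𝓝 (0 : ℝ), (u, (0 : ℝ)) ∈ U :=
      (by fun_prop : Continuous fun u : ℝ => (u, (0 : ℝ))).continuousAt (hU.mem_nhds hU0)
    filter_upwards [this] with u hu
    refine inner_cuspField_pv_normal_eq_zero hU hΨ hΩ hUΩ hn (fun x hx => ?_) hu
    rw [← hh, ← hpv hx, hgn x hx]
  have hO {k : ℝ × ℝ → ℝ} (hk : ContinuousAt k 0) : k =O[𝓝 0] fun _ => (1 : ℝ) :=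
    hk.tendsto.isBigO_one ℝ
  have hgram : (fun x : ℝ × ℝ => x.2 * x.2) =O[𝓝 0] fun x => gram (pu g x) (pv g x) := by
    have h0 : gram (a 0) (h 0) ≠ 0 := by
      refine gram_ne_zero _ _ (fun s t hst => ?_) fun hb => ?_
      · have : s • EuclideanSpace.single (0 : Fin 3) (1 : ℝ) = t • cuspDir 0 :=
          hinj (by rw [map_smul, map_smul]; exact hst)
        simpa [cuspDir] using congrFun (congrArg WithLp.ofLp this) 0
      · have : cuspDir 0 = 0 := hinj (by rw [map_zero]; exact hb)
        simpa [cuspDir] using congrFun (congrArg WithLp.ofLp this) 1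
    have hc : ContinuousAt (fun x => gram (a x) (h x)) 0 :=
      ((hac.inner hac).mul (hhc.inner hhc)).sub ((hac.inner hhc).pow 2)
    have := (isBigO_refl (fun x => gram (pu g x) (pv g x)) (𝓝 0)).mul (hO (hc.inv₀ h0))
    refine this.congr' ?_ (by simp)
    filter_upwards [hU0', hc.eventually_ne h0] with x hx hx0
    rw [hpu hx, hpv hx]
    have : gram (a x) (x.2 • h x) = x.2 * x.2 * gram (a x) (h x) := by
      simp only [gram, real_inner_smul_left, real_inner_smul_right]
      ring
    rw [this]
    exact mul_inv_cancel_right₀ hx0 _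
  have hv := isBigO_refl (fun x : ℝ × ℝ => x.2) (𝓝 0)
  have hM := hO (hhc.inner hnu)
  have hL := hO (hac.inner hnu)
  constructor
  · refine IsBigO.trans ?_ hgram
    have := ((hL.mul (hv.mul hs)).sub (((hv.mul hv).mul (hM.mul hM)).congr_right
      fun x => by ring))
    refine this.congr' ?_ (by simp)
    filter_upwards [hU0'] with x hx
    rw [hpu hx, hpv hx]
    simp only [gaussNum, real_inner_smul_left]
    ring
  · refine IsBigO.trans ?_ hgram
    have hE := hO (hac.inner hac)
    have hF := (hO (hac.inner hhc)).const_mul_left 2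
    have hG := hO (hhc.inner hhc)
    have := ((hE.mul (hv.mul hs)).sub (((hv.mul hv).mul (hF.mul hM)).congr_right
      fun x => by ring)).add (((hv.mul hv).mul (hG.mul hL)).congr_right fun x => by ring)
    refine this.congr' ?_ (by simp)
    filter_upwards [hU0'] with x hx
    rw [hpu hx, hpv hx]
    simp only [meanNum, real_inner_smul_left, real_inner_smul_right]
    ring

end CuspidalEdge

/-- At a `5/2`-cuspidal edge (a point where `f` is right-left equivalent to
`(u,v) ↦ (u, v², v⁵)`), both the mean curvature and the Gaussian curvature are bounded on
the set of regular points of some neighborhood. -/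
theorem mean_and_gauss_curvature_bounded_at_five_half_cuspidal_edge
    (f ν : ℝ × ℝ → E3) (p : ℝ × ℝ)
    (hf : ContDiff ℝ (⊤ : ℕ∞) f) (hν : ContDiff ℝ (⊤ : ℕ∞) ν)
    (hfrontal : ∀ q : ℝ × ℝ, ‖ν q‖ = 1 ∧ ⟪ν q, pu f q⟫ = 0 ∧ ⟪ν q, pv f q⟫ = 0)
    (U : Set (ℝ × ℝ)) (W : Set E3) (φ φi : ℝ × ℝ → ℝ × ℝ) (Φ Φi : E3 → E3)
    (hU : IsOpen U) (hU0 : (0, 0) ∈ U) (hφ : ContDiffOn ℝ (⊤ : ℕ∞) φ U) (hφ0 : φ (0, 0) = p)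
    (hUim : IsOpen (φ '' U)) (hφi : ContDiffOn ℝ (⊤ : ℕ∞) φi (φ '' U))
    (hφinv : ∀ q ∈ U, φi (φ q) = q) (hφinv' : ∀ q ∈ φ '' U, φ (φi q) = q)
    (hW : IsOpen W) (hWf : f p ∈ W) (hΦ : ContDiffOn ℝ (⊤ : ℕ∞) Φ W) (hΦ0 : Φ (f p) = 0)
    (hWim : IsOpen (Φ '' W)) (hΦi : ContDiffOn ℝ (⊤ : ℕ∞) Φi (Φ '' W))
    (hΦinv : ∀ x ∈ W, Φi (Φ x) = x) (hΦinv' : ∀ x ∈ Φ '' W, Φ (Φi x) = x)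
    (hmodel : ∀ q ∈ U, f (φ q) ∈ W ∧
      Φ (f (φ q)) = (WithLp.equiv 2 (Fin 3 → ℝ)).symm ![q.1, q.2 ^ 2, q.2 ^ 5]) :
    ∃ (V : Set (ℝ × ℝ)) (C : ℝ), IsOpen V ∧ p ∈ V ∧
      ∀ q ∈ V, Ec f q * Gc f q - Fc f q ^ 2 ≠ 0 →
        |meanCurv f ν q| ≤ C ∧ |gaussCurv f ν q| ≤ C := by
  have hgU {x} (hx : x ∈ U) : HasFDerivAt φ (fderiv ℝ φ x) x :=
    ((hφ.contDiffAt (hU.mem_nhds hx)).differentiableAt (by simp)).hasFDerivAt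
  have hcomp {k : ℝ × ℝ → E3} (hk : ContDiff ℝ (⊤ : ℕ∞) k) {x} (hx : x ∈ U) (X : ℝ × ℝ) :
      fderiv ℝ (fun x => k (φ x)) x X = (fderiv ℝ φ x X).1 • pu k (φ x) +
        (fderiv ℝ φ x X).2 • pv k (φ x) := by
    have hk' : HasFDerivAt k (fderiv ℝ k (φ x)) (φ x) :=
      (hk.differentiable (by simp) _).hasFDerivAt
    have hkφ : HasFDerivAt (fun x => k (φ x)) ((fderiv ℝ k (φ x)).comp (fderiv ℝ φ x)) x :=
      hk'.comp x (hgU hx)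
    rw [hkφ.fderiv, ContinuousLinearMap.comp_apply, fderiv_apply_eq_pu_pv]
  have hUΩ : ∀ x ∈ U, cuspModel x ∈ Φ '' W := fun x hx => by
    rw [← cuspModel_eq, ← (hmodel x hx).2]
    exact Set.mem_image_of_mem _ (hmodel x hx).1
  have hg : ∀ x ∈ U, f (φ x) = Φi (cuspModel x) := fun x hx => by
    rw [← cuspModel_eq, ← (hmodel x hx).2, hΦinv _ (hmodel x hx).1]
  have hΩ0 : cuspModel 0 ∈ Φ '' W := hUΩ _ hU0
  have hinj : Function.Injective (fderiv ℝ Φi (cuspModel 0)) := by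
    refine fderiv_injective_of_leftInverse
      ((hΦi.contDiffAt (hWim.mem_nhds hΩ0)).differentiableAt (by simp))
      ((hΦ.contDiffAt (hW.mem_nhds ?_)).differentiableAt (by simp)) ?_
    · rw [← hg 0 hU0]
      exact (hmodel _ hU0).1
    · exact (hWim.eventually_mem hΩ0).mono hΦinv'
  have hgn : ∀ x ∈ U, ⟪ν (φ x), pv (fun x => f (φ x)) x⟫ = 0 := fun x hx => by
    rw [pv, hcomp hf hx]
    simp [inner_add_right, real_inner_smul_right, hfrontal]
  obtain ⟨hK, hH⟩ := isBigO_gram (n := fun x => ν (φ x)) hU hU0 hΦi hWim hUΩ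
    (hν.comp_contDiffOn hφ) hg hgn hinj
  obtain ⟨C₁, hC₁⟩ := hK.bound
  obtain ⟨C₂, hC₂⟩ := hH.bound
  obtain ⟨B, hB, hBo, hB0⟩ := eventually_nhds_iff.1
    ((hC₁.and hC₂).and (hU.eventually_mem hU0))
  refine ⟨φ '' U ∩ φi ⁻¹' B, max C₁ C₂, hφi.continuousOn.isOpen_inter_preimage hUim hBo,
    ⟨⟨_, hU0, hφ0⟩, ?_⟩, ?_⟩
  · rw [← hφ0, Set.mem_preimage, hφinv _ hU0]
    exact hB0
  rintro _ ⟨⟨x, hx, rfl⟩, hxB⟩ hreg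
  rw [Set.mem_preimage, hφinv x hx] at hxB
  obtain ⟨⟨h₁, h₂⟩, -⟩ := hB x hxB
  have hdet := det_ne_zero_of_injective (fderiv_injective_of_leftInverse
    (hgU hx).differentiableAt
    ((hφi.contDiffAt (hUim.mem_nhds ⟨x, hx, rfl⟩)).differentiableAt (by simp))
    ((hU.eventually_mem hx).mono hφinv))
  obtain ⟨hL, hM, hM', hN⟩ := weingarten hf hν (fun q => (hfrontal q).2) (φ x)
  have hsymm : ⟪pu f (φ x), pv ν (φ x)⟫ = ⟪pv f (φ x), pu ν (φ x)⟫ := by linarith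
  have hpos := sq_pos_of_ne_zero hdet
  rw [pu, pv, pu, pv, hcomp hf hx, hcomp hf hx, hcomp hν hx, hcomp hν hx, gram_linear_change] at h₁ h₂
  rw [gaussNum_linear_change _ _ _ _ _ _ _ _ hsymm] at h₁
  rw [meanNum_linear_change _ _ _ _ _ _ _ _ hsymm] at h₂
  rw [Real.norm_eq_abs, Real.norm_eq_abs, abs_mul, abs_mul, abs_of_pos hpos, mul_left_comm] at h₁ h₂
  have hreg' : gram (pu f (φ x)) (pv f (φ x)) ≠ 0 := hreg
  have hgpos := abs_pos.2 hreg'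
  have h₁' := le_of_mul_le_mul_left h₁ hpos
  have h₂' := le_of_mul_le_mul_left h₂ hpos
  have hKeq : gaussCurv f ν (φ x) = gaussNum (pu f (φ x)) (pv f (φ x)) (pu ν (φ x))
      (pv ν (φ x)) / gram (pu f (φ x)) (pv f (φ x)) := by
    rw [gaussCurv, hL, hM', hN]
    simp only [Ec, Fc, Gc, gaussNum, gram]
    congr 1
    ring
  have hHeq : meanCurv f ν (φ x) = -(meanNum (pu f (φ x)) (pv f (φ x)) (pu ν (φ x))
      (pv ν (φ x)) / gram (pu f (φ x)) (pv f (φ x))) / 2 := by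
    rw [meanCurv, hL, hM', hN]
    simp only [Ec, Fc, Gc, meanNum, gram] at hreg ⊢
    field_simp
    ring
  have hC₁ := (div_le_iff₀ hgpos).2 h₁'
  have hC₂ := (div_le_iff₀ hgpos).2 h₂'
  rw [← abs_div] at hC₁ hC₂
  constructor
  · rw [hHeq, abs_div, abs_neg, abs_two]
    exact (half_le_self (abs_nonneg _)).trans (hC₂.trans (le_max_right _ _))
  · rw [hKeq]
    exact hC₁.trans (le_max_left _ _)
end
end

section
/- Let f and ν satisfy the adapted coordinate conditions at a non-degenerate singular point p = (0,0) of the second kind as in the context. Then: (a) there exists a C^∞ function Ĥ on a neighborhood of p such that Ĥ(u,v) = v·H(u,v) at every point with v ≠ 0, and 2·Ĥ(0,0) = κ_H(p) := −⟨f_uv(0,0), ∂_u ν(0,0)⟩ / ‖f_uv(0,0) × f_v(0,0)‖²; and (b) there exists a C^∞ function K̂ on a neighborhood of p such that K̂(u,v) = v·K(u,v) at every point with v ≠ 0, and K̂(u,0) = 2·Ĥ(u,0) · ⟨f_vv(u,0), ν(u,0)⟩/‖f_v(u,0)‖² for all u near 0 (i.e. K̂ = 2Ĥ·κ_ν along the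 singular curve). -/
open scoped RealInnerProductSpace
open Filter

noncomputable section

theorem ContDiff.parametric_intervalIntegral_nat {H : Type} [NormedAddCommGroup H]
    [NormedSpace ℝ H] [ProperSpace H] (a b : ℝ) (n : ℕ) :
    ∀ {E : Type} [NormedAddCommGroup E] [NormedSpace ℝ E] [CompleteSpace E]
      {F : H × ℝ → E}, ContDiff ℝ n F → ContDiff ℝ n fun x => ∫ t in a..b, F (x, t) := by
  induction n with
  | zero =>
    intro E _ _ _ F hF
    have hc : Continuous F := hF.continuous
    exact contDiff_zero.2
      (intervalIntegral.continuous_parametric_intervalIntegral_of_continuous' (by fun_prop) a b)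
  | succ n ih =>
    intro E _ _ _ F hF
    let F' : H × ℝ → H →L[ℝ] E := fun p => (fderiv ℝ F p).comp (ContinuousLinearMap.inl ℝ H ℝ)
    have hF' : ContDiff ℝ n F' := by
      have : ContDiff ℝ n (fderiv ℝ F) := hF.fderiv_right (by norm_cast)
      exact this.clm_comp contDiff_const
    have hc : Continuous F := hF.continuous
    have hc' : Continuous F' := hF'.continuous
    have hd : Differentiable ℝ F := hF.differentiable (by simp)
    refine contDiff_succ_iff_hasFDerivAt.2 ⟨fun x => ∫ t in a..b, F' (x, t), ih hF', fun x => ?_⟩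
    obtain ⟨C, hC⟩ := ((isCompact_closedBall x 1).prod
      (isCompact_uIcc (a := a) (b := b))).exists_bound_of_continuousOn hc'.continuousOn
    refine intervalIntegral.hasFDerivAt_integral_of_dominated_of_fderiv_le
      (F' := fun y t => F' (y, t)) (bound := fun _ => C)
      (Metric.closedBall_mem_nhds x one_pos)
      (Eventually.of_forall fun y => ?_) ?_ ?_ ?_ intervalIntegrable_const ?_
    · exact (show Continuous fun t => F (y, t) by fun_prop).aestronglyMeasurable
    · exact (show Continuous fun t => F (x, t) by fun_prop).intervalIntegrable a b
    · exact (show Continuous fun t => F' (x, t) by fun_prop).aestronglyMeasurable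
    · exact Eventually.of_forall fun t ht y hy => hC (y, t) ⟨hy, Set.uIoc_subset_uIcc ht⟩
    · refine Eventually.of_forall fun t _ y _ => ?_
      exact (hd (y, t)).hasFDerivAt.comp y (hasFDerivAt_prodMk_left y t)

theorem ContDiff.parametric_intervalIntegral {H E : Type} [NormedAddCommGroup H]
    [NormedSpace ℝ H] [ProperSpace H] [NormedAddCommGroup E] [NormedSpace ℝ E] [CompleteSpace E]
    (a b : ℝ) {F : H × ℝ → E} (hF : ContDiff ℝ (⊤ : ℕ∞) F) :
    ContDiff ℝ (⊤ : ℕ∞) fun x => ∫ t in a..b, F (x, t) :=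
  contDiff_infty.2 fun n =>
    ContDiff.parametric_intervalIntegral_nat a b n (contDiff_infty.1 hF n)

section PartialDerivatives

variable {E : Type} [NormedAddCommGroup E] [NormedSpace ℝ E]

theorem ContDiff.pu {f : ℝ × ℝ → E} (hf : ContDiff ℝ (⊤ : ℕ∞) f) :
    ContDiff ℝ (⊤ : ℕ∞) (pu f) :=
  (contDiff_infty_iff_fderiv.1 hf).2.clm_apply contDiff_const

theorem ContDiff.pv {f : ℝ × ℝ → E} (hf : ContDiff ℝ (⊤ : ℕ∞) f) :
    ContDiff ℝ (⊤ : ℕ∞) (pv f) :=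
  (contDiff_infty_iff_fderiv.1 hf).2.clm_apply contDiff_const

theorem pu_pv_comm {f : ℝ × ℝ → E} (hf : ContDiff ℝ (⊤ : ℕ∞) f) (q : ℝ × ℝ) :
    pu (pv f) q = pv (pu f) q := by
  have hd : DifferentiableAt ℝ (fderiv ℝ f) q :=
    ((contDiff_infty_iff_fderiv.1 hf).2.differentiable (by simp)) q
  have hs : IsSymmSndFDerivAt ℝ f q :=
    (contDiff_infty.1 hf 2).contDiffAt.isSymmSndFDerivAt (by simp)
  have key : ∀ w z : ℝ × ℝ,
      fderiv ℝ (fun p => fderiv ℝ f p w) q z = fderiv ℝ (fderiv ℝ f) q z w := fun w z => by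
    rw [fderiv_clm_apply hd (differentiableAt_const w)]; simp
  exact (key _ _).trans ((hs _ _).trans (key _ _).symm)

/-- Hadamard's lemma in the second variable. -/
theorem exists_contDiff_eq_add_smul [CompleteSpace E] {g : ℝ × ℝ → E}
    (hg : ContDiff ℝ (⊤ : ℕ∞) g) :
    ∃ h : ℝ × ℝ → E, ContDiff ℝ (⊤ : ℕ∞) h ∧ (∀ u, h (u, 0) = pv g (u, 0)) ∧
      ∀ q : ℝ × ℝ, g q = g (q.1, 0) + q.2 • h q := by
  have hg' := hg.pv
  refine ⟨fun q => ∫ t in (0 : ℝ)..1, pv g (q.1, t * q.2), ?_, fun u => by simp, fun q => ?_⟩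
  · exact ContDiff.parametric_intervalIntegral 0 1
      (F := fun p : (ℝ × ℝ) × ℝ => pv g (p.1.1, p.2 * p.1.2)) (hg'.comp (by fun_prop))
  · have hd : ∀ t ∈ Set.uIcc (0 : ℝ) 1,
        HasDerivAt (fun s => g (q.1, s * q.2)) (q.2 • pv g (q.1, t * q.2)) t := fun t _ => by
      have h1 : HasDerivAt (fun s : ℝ => (q.1, s * q.2)) ((0 : ℝ), q.2) t := by
        simpa using (hasDerivAt_const t q.1).prodMk ((hasDerivAt_id t).mul_const q.2)
      have h2 := ((hg.differentiable (by simp)) (q.1, t * q.2)).hasFDerivAt.comp_hasDerivAt t h1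
      have h3 : ((0 : ℝ), q.2) = q.2 • ((0 : ℝ), (1 : ℝ)) := by simp
      rw [h3, map_smul] at h2
      exact h2
    have hc : Continuous fun t => q.2 • pv g (q.1, t * q.2) :=
      (hg'.continuous.comp (by fun_prop : Continuous fun t : ℝ => (q.1, t * q.2))).const_smul q.2
    have := intervalIntegral.integral_eq_sub_of_hasDerivAt hd (hc.intervalIntegrable 0 1)
    rw [intervalIntegral.integral_smul] at this
    simp [this]

end PartialDerivatives

theorem inner_fderiv_eq_neg_of_inner_eq_zero {E : Type} [NormedAddCommGroup E]
    [InnerProductSpace ℝ E] {X ν : ℝ × ℝ → E} {q : ℝ × ℝ} (hX : DifferentiableAt ℝ X q)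
    (hν : DifferentiableAt ℝ ν q) (h : ∀ p, ⟪ν p, X p⟫ = 0) (w : ℝ × ℝ) :
    ⟪fderiv ℝ X q w, ν q⟫ = -⟪X q, fderiv ℝ ν q w⟫ := by
  have h1 := fderiv_inner_apply ℝ hν hX w
  simp only [h, fderiv_fun_const, Pi.zero_apply, _root_.zero_apply] at h1
  rw [real_inner_comm (ν q), real_inner_comm (fderiv ℝ ν q w)]
  linarith

/-- Lagrange's identity. -/
theorem norm_cross3_sq (a b : E3) :
    ‖cross3 a b‖ ^ 2 = ⟪a, a⟫ * ⟪b, b⟫ - ⟪a, b⟫ ^ 2 := by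
  rw [← real_inner_self_eq_norm_sq]
  simp only [cross3, WithLp.equiv_symm_apply, PiLp.inner_apply, Fin.sum_univ_three,
    RCLike.inner_apply, conj_trivial, Matrix.cons_val]
  ring

theorem gram_det_ne_zero {E : Type*} [NormedAddCommGroup E] [InnerProductSpace ℝ E] {x y : E}
    (h : LinearIndependent ℝ ![x, y]) : ⟪x, x⟫ * ⟪y, y⟫ - ⟪x, y⟫ ^ 2 ≠ 0 := by
  intro h0
  have hz : ⟪y, y⟫ • x + (-⟪x, y⟫) • y = 0 := by
    rw [← inner_self_eq_zero (𝕜 := ℝ)]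
    simp only [inner_add_left, inner_add_right, real_inner_smul_left, real_inner_smul_right,
      real_inner_comm x y]
    linear_combination ⟪y, y⟫ * h0
  have := (LinearIndependent.pair_iff.1 h _ _ hz).1
  exact h.ne_zero 1 (inner_self_eq_zero.1 this)

/-- The second fundamental form of a frontal through the derivative of the unit normal. -/
theorem inner_normal_derivatives {f ν : ℝ × ℝ → E3}
    (hf : ContDiff ℝ (⊤ : ℕ∞) f) (hν : ContDiff ℝ (⊤ : ℕ∞) ν)
    (hu : ∀ q, ⟪ν q, pu f q⟫ = 0) (hv : ∀ q, ⟪ν q, pv f q⟫ = 0) (q : ℝ × ℝ) :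
    Lc f ν q = -⟪pu f q, pu ν q⟫ ∧ Mc f ν q = -⟪pu f q, pv ν q⟫ ∧
      Mc f ν q = -⟪pv f q, pu ν q⟫ ∧ Nc f ν q = -⟪pv f q, pv ν q⟫ := by
  have dν := hν.differentiable (by simp) q
  have du := hf.pu.differentiable (by simp) q
  have dv := hf.pv.differentiable (by simp) q
  refine ⟨inner_fderiv_eq_neg_of_inner_eq_zero du dν hu _,
    inner_fderiv_eq_neg_of_inner_eq_zero du dν hu _, ?_,
    inner_fderiv_eq_neg_of_inner_eq_zero dv dν hv _⟩
  rw [Mc, ← pu_pv_comm hf]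
  exact inner_fderiv_eq_neg_of_inner_eq_zero dv dν hv _

/-- At a non-degenerate singular point of the second kind in adapted coordinates:
(a) `v·H` extends to a smooth function `Ĥ` with
`2Ĥ(0,0) = κ_H(p) = −⟨f_uv, ν_u⟩/‖f_uv × f_v‖²` at the origin, and
(b) `v·K` extends to a smooth function `K̂` with `K̂ = 2Ĥ·κ_ν` along the singular curve,
where `κ_ν(u) = ⟨f_vv, ν⟩/‖f_v‖²` at `(u,0)`. -/
theorem second_kind_mean_and_gauss_extension
    (f ν : ℝ × ℝ → E3) (ε : ℝ → ℝ)
    (hf : ContDiff ℝ (⊤ : ℕ∞) f) (hν : ContDiff ℝ (⊤ : ℕ∞) ν)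
    (hfrontal : ∀ q : ℝ × ℝ, ‖ν q‖ = 1 ∧ ⟪ν q, pu f q⟫ = 0 ∧ ⟪ν q, pv f q⟫ = 0)
    (hε : ContDiff ℝ (⊤ : ℕ∞) ε) (hε0 : ε 0 = 0)
    (hfu0 : pu f (0, 0) = 0) (hfv1 : ‖pv f (0, 0)‖ = 1)
    (hnull : ∀ᶠ u in nhds (0 : ℝ), pu f (u, 0) + ε u • pv f (u, 0) = 0)
    (hnd : LinearIndependent ℝ ![pv (pu f) (0, 0), pv f (0, 0)])
    (hreg : ∀ᶠ q in nhds ((0, 0) : ℝ × ℝ), q.2 ≠ 0 → Ec f q * Gc f q - Fc f q ^ 2 ≠ 0) :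
    ∃ (W : Set (ℝ × ℝ)) (Hhat Khat : ℝ × ℝ → ℝ), IsOpen W ∧ (0, 0) ∈ W ∧
      ContDiffOn ℝ (⊤ : ℕ∞) Hhat W ∧ ContDiffOn ℝ (⊤ : ℕ∞) Khat W ∧
      (∀ q ∈ W, q.2 ≠ 0 → Hhat q = q.2 * meanCurv f ν q) ∧
      (∀ q ∈ W, q.2 ≠ 0 → Khat q = q.2 * gaussCurv f ν q) ∧
      2 * Hhat (0, 0) =
        -⟪pv (pu f) (0, 0), pu ν (0, 0)⟫ /
          ‖cross3 (pv (pu f) (0, 0)) (pv f (0, 0))‖ ^ 2 ∧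
      (∀ u : ℝ, (u, 0) ∈ W →
        Khat (u, 0) =
          2 * Hhat (u, 0) * (⟪pv (pv f) (u, 0), ν (u, 0)⟫ / ‖pv f (u, 0)‖ ^ 2)) := by
  have hFu : ContDiff ℝ (⊤ : ℕ∞) (pu f) := hf.pu
  have hFv : ContDiff ℝ (⊤ : ℕ∞) (pv f) := hf.pv
  have hεfst : ContDiff ℝ (⊤ : ℕ∞) fun q : ℝ × ℝ => ε q.1 := hε.comp contDiff_fst
  have hg : ContDiff ℝ (⊤ : ℕ∞) fun q : ℝ × ℝ => pu f q + ε q.1 • pv f q :=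
    hFu.add (hεfst.smul hFv)
  obtain ⟨h, hh, hh0, hgh⟩ := exists_contDiff_eq_add_smul hg
  have h00 : h (0, 0) = pv (pu f) (0, 0) := by
    have d1 := hFu.differentiable (by simp) (0, 0)
    have d2 := hFv.differentiable (by simp) (0, 0)
    have d3 : HasFDerivAt (fun q : ℝ × ℝ => ε q.1)
        ((fderiv ℝ ε 0).comp (ContinuousLinearMap.fst ℝ ℝ ℝ)) (0, 0) :=
      (hε.differentiable (by simp) 0).hasFDerivAt.comp ((0, 0) : ℝ × ℝ) hasFDerivAt_fst
    have d4 := (d1.hasFDerivAt.add (d3.smul d2.hasFDerivAt)).fderiv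
    rw [hh0]
    change fderiv ℝ (pu f + (fun q : ℝ × ℝ => ε q.1) • pv f) (0, 0) (0, 1) = _
    rw [d4]
    simp [hε0, pv]
  obtain ⟨U, hU, hUo, h0U⟩ := eventually_nhds_iff.1 hnull
  have hfu : ∀ q : ℝ × ℝ, q.1 ∈ U → pu f q = q.2 • h q - ε q.1 • pv f q := fun q hq => by
    have := hgh q
    rw [hU q.1 hq, zero_add] at this
    exact eq_sub_of_add_eq this
  have hform := inner_normal_derivatives hf hν (fun q => (hfrontal q).2.1)
    (fun q => (hfrontal q).2.2)
  let D : ℝ × ℝ → ℝ := fun q => ⟪h q, h q⟫ * Gc f q - ⟪h q, pv f q⟫ ^ 2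
  let a : ℝ × ℝ → ℝ := fun q => ⟪h q, pu ν q⟫
  let b : ℝ × ℝ → ℝ := fun q => ⟪h q, pv ν q⟫
  have ha : ContDiff ℝ (⊤ : ℕ∞) a := hh.inner ℝ hν.pu
  have hb : ContDiff ℝ (⊤ : ℕ∞) b := hh.inner ℝ hν.pv
  have hG : ContDiff ℝ (⊤ : ℕ∞) (Gc f) := hFv.inner ℝ hFv
  have hM : ContDiff ℝ (⊤ : ℕ∞) (Mc f ν) := hFu.pv.inner ℝ hν
  have hN : ContDiff ℝ (⊤ : ℕ∞) (Nc f ν) := hFv.pv.inner ℝ hν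
  have he : ContDiff ℝ (⊤ : ℕ∞) fun q => ⟪h q, h q⟫ := hh.inner ℝ hh
  have hφ : ContDiff ℝ (⊤ : ℕ∞) fun q => ⟪h q, pv f q⟫ := hh.inner ℝ hFv
  have hD : ContDiff ℝ (⊤ : ℕ∞) D := (he.mul hG).sub (hφ.pow 2)
  have hM' : ∀ q : ℝ × ℝ, q.1 ∈ U → Mc f ν q = -q.2 * b q - ε q.1 * Nc f ν q := fun q hq => by
    obtain ⟨-, h2, -, h4⟩ := hform q
    rw [hfu q hq, inner_sub_left, real_inner_smul_left, real_inner_smul_left] at h2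
    linear_combination h2 + ε q.1 * h4
  have hL' : ∀ q : ℝ × ℝ, q.1 ∈ U → Lc f ν q = -q.2 * a q - ε q.1 * Mc f ν q := fun q hq => by
    obtain ⟨h1, -, h3, -⟩ := hform q
    rw [hfu q hq, inner_sub_left, real_inner_smul_left, real_inner_smul_left] at h1
    linear_combination h1 + ε q.1 * h3
  have hE' : ∀ q : ℝ × ℝ, q.1 ∈ U → Ec f q = q.2 ^ 2 * ⟪h q, h q⟫
      - 2 * q.2 * ε q.1 * ⟪h q, pv f q⟫ + ε q.1 ^ 2 * Gc f q := fun q hq => by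
    rw [Ec, hfu q hq, Gc]
    simp only [inner_sub_left, inner_sub_right, real_inner_smul_left, real_inner_smul_right,
      real_inner_comm (h q) (pv f q)]
    ring
  have hF' : ∀ q : ℝ × ℝ, q.1 ∈ U → Fc f q = q.2 * ⟪h q, pv f q⟫ - ε q.1 * Gc f q :=
    fun q hq => by
      rw [Fc, hfu q hq, inner_sub_left, real_inner_smul_left, real_inner_smul_left, Gc]
  have hdet : ∀ q : ℝ × ℝ, q.1 ∈ U → Ec f q * Gc f q - Fc f q ^ 2 = q.2 ^ 2 * D q :=
    fun q hq => by
      rw [hE' q hq, hF' q hq]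
      ring
  have hDW : ∀ q ∈ {q : ℝ × ℝ | q.1 ∈ U} ∩ {q | D q ≠ 0}, D q ≠ 0 := fun q hq => hq.2
  refine ⟨{q | q.1 ∈ U} ∩ {q | D q ≠ 0},
    fun q => (q.2 * (⟪h q, h q⟫ * Nc f ν q + 2 * ⟪h q, pv f q⟫ * b q)
      - Gc f q * (a q + ε q.1 * b q)) / (2 * D q),
    fun q => (b q * Mc f ν q - a q * Nc f ν q) / D q,
    (hUo.preimage continuous_fst).inter (isOpen_ne_fun hD.continuous continuous_const),
    ⟨h0U, ?_⟩, ?_, ?_, ?_, ?_, ?_, ?_⟩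
  · change ⟪h (0, 0), h (0, 0)⟫ * Gc f (0, 0) - ⟪h (0, 0), pv f (0, 0)⟫ ^ 2 ≠ 0
    rw [h00]
    exact gram_det_ne_zero hnd
  · refine ContDiffOn.div (ContDiff.contDiffOn ?_) (ContDiff.contDiffOn ?_)
      fun q hq => mul_ne_zero two_ne_zero (hDW q hq)
    · exact (contDiff_snd.mul ((he.mul hN).add ((contDiff_const.mul hφ).mul hb))).sub
        (hG.mul (ha.add (hεfst.mul hb)))
    · exact contDiff_const.mul hD
  · exact ((hb.mul hM).sub (ha.mul hN)).contDiffOn.div hD.contDiffOn hDW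
  · rintro q ⟨hq, hDq⟩ hv
    replace hDq : D q ≠ 0 := hDq
    rw [meanCurv, hdet q hq, hE' q hq, hF' q hq, hL' q hq, hM' q hq]
    field_simp
    ring
  · rintro q ⟨hq, hDq⟩ hv
    replace hDq : D q ≠ 0 := hDq
    beta_reduce
    rw [gaussCurv, hdet q hq, hL' q hq, hM' q hq]
    field_simp
    ring
  · have hG0 : Gc f (0, 0) = 1 := by rw [Gc, real_inner_self_eq_norm_sq, hfv1, one_pow]
    have hD0 : D (0, 0) = ‖cross3 (pv (pu f) (0, 0)) (pv f (0, 0))‖ ^ 2 := by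
      rw [norm_cross3_sq, ← h00]
      rfl
    simp only [hG0, hε0, hD0, a, h00]
    ring
  · rintro u ⟨hu, hDu⟩
    replace hDu : D (u, 0) ≠ 0 := hDu
    have hG0 : Gc f (u, 0) ≠ 0 := fun h0 => hDu <| by
      have : pv f (u, 0) = 0 := inner_self_eq_zero.1 h0
      simp [D, h0, this]
    rw [← real_inner_self_eq_norm_sq]
    change _ = _ * (Nc f ν (u, 0) / Gc f (u, 0))
    simp only [hM' (u, 0) hu]
    field_simp
    ring
end
end

section
/- Let f and ν satisfy the strongly adapted coordinate conditions at a non-degenerate singular point p = (0,0) of the second kind as in the context, and assume ε(u) ≠ 0 for all u ≠ 0 near 0 (so the singular points (u,0) with u ≠ 0 are of the first kind). For u ≠ 0 set γ̂(u) := f(u,0), |κ_s(u)| := |det(γ̂'(u), γ̂''(u), ν(u,0))|/‖γ̂'(u)‖³ (unsigned singular curvature), f_η := f_u + ε(u) f_v, f_ηη := ∂_u f_η + ε(u) ∂_v f_η, f_ηηη := ∂_u f_ηη + ε(u) ∂_v f_ηη, and |κ_c(u)| := ‖f_u(u,0)‖^{3/2} · |det(f_u(u,0), f_ηη(u,0),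 f_ηηη(u,0))| / ‖f_u(u,0) × f_ηη(u,0)‖^{5/2} (unsigned cuspidal curvature). Then κ_s(u) ≠ 0 for all sufficiently small u ≠ 0 and lim_{u→0} |κ_c(u)| / (2·|κ_s(u)|^{1/2}) = |κ_H(p)|, where κ_H(p) := −⟨f_uv(0,0), ∂_u ν(0,0)⟩ / ‖f_uv(0,0)‖². -/
open scoped RealInnerProductSpace
open Filter

noncomputable section

section PartialDerivatives

variable {E : Type*} [NormedAddCommGroup E] [NormedSpace ℝ E]

lemma contDiff_pu {g : ℝ × ℝ → E} (hg : ContDiff ℝ (⊤ : ℕ∞) g) :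
    ContDiff ℝ (⊤ : ℕ∞) (pu g) :=
  (hg.fderiv_right (m := (⊤ : ℕ∞)) (by simp)).clm_apply contDiff_const

lemma contDiff_pv {g : ℝ × ℝ → E} (hg : ContDiff ℝ (⊤ : ℕ∞) g) :
    ContDiff ℝ (⊤ : ℕ∞) (pv g) :=
  (hg.fderiv_right (m := (⊤ : ℕ∞)) (by simp)).clm_apply contDiff_const

lemma hasDerivAt_pu_s15 {g : ℝ × ℝ → E} (hg : ContDiff ℝ (⊤ : ℕ∞) g) (u v : ℝ) :
    HasDerivAt (fun t => g (t, v)) (pu g (u, v)) u :=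
  ((hg.differentiable (by simp)) (u, v)).hasFDerivAt.comp_hasDerivAt u
    ((hasDerivAt_id u).prodMk (hasDerivAt_const u v))

lemma hasDerivAt_pv_s15 {g : ℝ × ℝ → E} (hg : ContDiff ℝ (⊤ : ℕ∞) g) (u v : ℝ) :
    HasDerivAt (fun t => g (u, t)) (pv g (u, v)) v :=
  ((hg.differentiable (by simp)) (u, v)).hasFDerivAt.comp_hasDerivAt v
    ((hasDerivAt_const v u).prodMk (hasDerivAt_id v))

lemma pv_pu_comm {g : ℝ × ℝ → E} (hg : ContDiff ℝ (⊤ : ℕ∞) g) (q : ℝ × ℝ) :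
    pv (pu g) q = pu (pv g) q := by
  have hd : DifferentiableAt ℝ (fderiv ℝ g) q :=
    (hg.fderiv_right (m := (⊤ : ℕ∞)) (by simp)).differentiable (by simp) q
  have hs : IsSymmSndFDerivAt ℝ g q := hg.contDiffAt.isSymmSndFDerivAt (by
    rw [minSmoothness_of_isRCLikeNormedField]; exact WithTop.coe_le_coe.2 (le_top : (2 : ℕ∞) ≤ ⊤))
  have h1 : pv (pu g) q = fderiv ℝ (fderiv ℝ g) q (0, 1) (1, 0) := by
    unfold pv pu
    rw [fderiv_clm_apply hd (differentiableAt_const _)]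
    simp
  have h2 : pu (pv g) q = fderiv ℝ (fderiv ℝ g) q (1, 0) (0, 1) := by
    unfold pv pu
    rw [fderiv_clm_apply hd (differentiableAt_const _)]
    simp
  rw [h1, h2]
  exact hs _ _

lemma contDiff_null_deriv {g : ℝ × ℝ → E} {ε : ℝ → ℝ} (hg : ContDiff ℝ (⊤ : ℕ∞) g)
    (hε : ContDiff ℝ (⊤ : ℕ∞) ε) :
    ContDiff ℝ (⊤ : ℕ∞) (fun q : ℝ × ℝ => pu g q + ε q.1 • pv g q) :=
  (contDiff_pu hg).add ((hε.comp contDiff_fst).smul (contDiff_pv hg))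

lemma pv_null_deriv {g : ℝ × ℝ → E} {ε : ℝ → ℝ} (hg : ContDiff ℝ (⊤ : ℕ∞) g)
    (hε : ContDiff ℝ (⊤ : ℕ∞) ε) (u v : ℝ) :
    pv (fun q : ℝ × ℝ => pu g q + ε q.1 • pv g q) (u, v) =
      pv (pu g) (u, v) + ε u • pv (pv g) (u, v) :=
  (hasDerivAt_pv_s15 (contDiff_null_deriv hg hε) u v).unique
    ((hasDerivAt_pv_s15 (contDiff_pu hg) u v).add
      ((hasDerivAt_pv_s15 (contDiff_pv hg) u v).const_smul (ε u)))

/-- If the null derivative of `g` vanishes along the `u`-axis near `u`, this is its second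
null derivative there. -/
lemma null_deriv_null_deriv {g : ℝ × ℝ → E} {ε : ℝ → ℝ} (hg : ContDiff ℝ (⊤ : ℕ∞) g) {u : ℝ}
    (h0 : ∀ᶠ t in nhds u, g (t, 0) = 0) :
    pu g (u, 0) + ε u • pv g (u, 0) = ε u • pv g (u, 0) := by
  have h : pu g (u, 0) = 0 :=
    (hasDerivAt_pu_s15 hg u 0).unique ((hasDerivAt_const u (0 : E)).congr_of_eventuallyEq h0)
  rw [h, zero_add]

lemma null_deriv_null_deriv_null_deriv {g : ℝ × ℝ → E} {ε : ℝ → ℝ}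
    (hg : ContDiff ℝ (⊤ : ℕ∞) g) (hε : ContDiff ℝ (⊤ : ℕ∞) ε) {u : ℝ}
    (h0 : ∀ᶠ t in nhds u, g (t, 0) = 0) :
    let g' : ℝ × ℝ → E := fun q => pu g q + ε q.1 • pv g q
    pu g' (u, 0) + ε u • pv g' (u, 0) =
      deriv ε u • pv g (u, 0) +
        ε u • ((2 : ℝ) • pu (pv g) (u, 0) + ε u • pv (pv g) (u, 0)) := by
  intro g'
  have h1 : pu g' (u, 0) = ε u • pu (pv g) (u, 0) + deriv ε u • pv g (u, 0) := by
    refine (hasDerivAt_pu_s15 (contDiff_null_deriv hg hε) u 0).unique ?_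
    refine (((hε.differentiable (by simp) u).hasDerivAt).smul
      (hasDerivAt_pu_s15 (contDiff_pv hg) u 0)).congr_of_eventuallyEq ?_
    filter_upwards [eventually_eventually_nhds.2 h0] with t ht
    exact null_deriv_null_deriv hg ht
  have h2 : pv g' (u, 0) = pu (pv g) (u, 0) + ε u • pv (pv g) (u, 0) := by
    rw [pv_null_deriv hg hε, pv_pu_comm hg]
  rw [h1, h2]
  module

end PartialDerivatives

section Algebra

lemma det3_apply (a b c : E3) : det3 a b c =
    a 0 * (b 1 * c 2 - c 1 * b 2) - b 0 * (a 1 * c 2 - c 1 * a 2)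
      + c 0 * (a 1 * b 2 - b 1 * a 2) := by
  simp [det3, Matrix.det_fin_three]; ring

lemma inner_E3 (a b : E3) : ⟪a, b⟫ = a 0 * b 0 + a 1 * b 1 + a 2 * b 2 := by
  simp [PiLp.inner_apply, Fin.sum_univ_three]; ring

lemma norm_sq_E3 (a : E3) : ‖a‖ ^ 2 = a 0 * a 0 + a 1 * a 1 + a 2 * a 2 := by
  rw [← real_inner_self_eq_norm_sq, inner_E3]

lemma det3_mul_det3_of_orthogonal {a b n c : E3} (ha : ‖a‖ = 1) (hab : ⟪a, b⟫ = 0)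
    (hna : ⟪n, a⟫ = 0) (hnb : ⟪n, b⟫ = 0) :
    det3 a b n * det3 a b c = ‖b‖ ^ 2 * ⟪n, c⟫ := by
  have ha' : a 0 * a 0 + a 1 * a 1 + a 2 * a 2 = 1 := by rw [← norm_sq_E3, ha, one_pow]
  have hgram : det3 a b n * det3 a b c =
      ⟪a, a⟫ * (⟪b, b⟫ * ⟪n, c⟫ - ⟪n, b⟫ * ⟪b, c⟫)
      - ⟪a, b⟫ * (⟪a, b⟫ * ⟪n, c⟫ - ⟪n, a⟫ * ⟪b, c⟫)
      + ⟪a, c⟫ * (⟪a, b⟫ * ⟪n, b⟫ - ⟪b, b⟫ * ⟪n, a⟫) := by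
    simp only [det3_apply, inner_E3]; ring
  rw [hgram, hab, hna, hnb, real_inner_self_eq_norm_sq, real_inner_self_eq_norm_sq, ha]
  ring

lemma abs_det3_of_orthonormal {a b n : E3} (ha : ‖a‖ = 1) (hn : ‖n‖ = 1)
    (hab : ⟪a, b⟫ = 0) (hna : ⟪n, a⟫ = 0) (hnb : ⟪n, b⟫ = 0) :
    |det3 a b n| = ‖b‖ := by
  have h := det3_mul_det3_of_orthogonal (c := n) ha hab hna hnb
  rw [real_inner_self_eq_norm_sq, hn, one_pow, mul_one, ← sq] at h
  rw [← abs_of_nonneg (norm_nonneg b)]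
  exact (sq_eq_sq_iff_abs_eq_abs _ _).1 h

lemma abs_det3_of_orthogonal {a b n : E3} (c : E3) (ha : ‖a‖ = 1) (hn : ‖n‖ = 1)
    (hb : b ≠ 0) (hab : ⟪a, b⟫ = 0) (hna : ⟪n, a⟫ = 0) (hnb : ⟪n, b⟫ = 0) :
    |det3 a b c| = ‖b‖ * |⟪n, c⟫| := by
  have h := congrArg abs (det3_mul_det3_of_orthogonal (c := c) ha hab hna hnb)
  rw [abs_mul, abs_mul, abs_det3_of_orthonormal ha hn hab hna hnb, abs_pow, abs_norm] at h
  have hb' : ‖b‖ ≠ 0 := norm_ne_zero_iff.2 hb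
  apply mul_left_cancel₀ hb'
  rw [h]; ring

lemma norm_cross3_of_orthogonal {a b : E3} (ha : ‖a‖ = 1) (hab : ⟪a, b⟫ = 0) :
    ‖cross3 a b‖ = ‖b‖ := by
  have h : ‖cross3 a b‖ ^ 2 = ‖a‖ ^ 2 * ‖b‖ ^ 2 - ⟪a, b⟫ ^ 2 := by
    simp only [norm_sq_E3, inner_E3, cross3, WithLp.equiv_symm_apply, Matrix.cons_val_zero,
      Matrix.cons_val_one, Matrix.cons_val]
    ring
  rw [ha, hab] at h
  have h' : ‖cross3 a b‖ ^ 2 = ‖b‖ ^ 2 := by linarith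
  exact (sq_eq_sq₀ (norm_nonneg _) (norm_nonneg _)).1 h'

lemma cross3_smul_smul (r s : ℝ) (a b : E3) :
    cross3 (r • a) (s • b) = (r * s) • cross3 a b := by
  ext i; fin_cases i <;> simp [cross3] <;> ring

lemma det3_first_derivs (e d : ℝ) (a b n : E3) :
    det3 (-(e • a)) (-(d • a) - e • b) n = e ^ 2 * det3 a b n := by
  simp [det3_apply]; ring

lemma det3_null_derivs (e d : ℝ) (a b c : E3) :
    det3 (-(e • a)) (e • b) (d • b + e • c) = -e ^ 3 * det3 a b c := by
  simp [det3_apply]; ring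

lemma continuous_det3 {X : Type*} [TopologicalSpace X] {a b c : X → E3} (ha : Continuous a)
    (hb : Continuous b) (hc : Continuous c) :
    Continuous (fun x => det3 (a x) (b x) (c x)) := by
  simp only [det3_apply]; fun_prop

lemma continuous_cross3 {X : Type*} [TopologicalSpace X] {a b : X → E3} (ha : Continuous a)
    (hb : Continuous b) : Continuous (fun x => cross3 (a x) (b x)) := by
  unfold cross3
  simp only [WithLp.equiv_symm_apply]
  refine (PiLp.continuous_toLp 2 _).comp (continuous_pi fun i => ?_)
  fin_cases i <;> simp <;> fun_prop

lemma curvature_quotient_scaling {e n c x s : ℝ} (he : 0 < e) (hn : 0 ≤ n) (hx : 0 ≤ x) :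
    (e * n) ^ ((3 : ℝ) / 2) * (e ^ 3 * c) / (e ^ 2 * x) ^ ((5 : ℝ) / 2) /
        (2 * Real.sqrt (e ^ 2 * s / (e * n) ^ 3)) =
      n ^ ((3 : ℝ) / 2) * c / x ^ ((5 : ℝ) / 2) / (2 * Real.sqrt (s / n ^ 3)) := by
  obtain ⟨t, ht, rfl⟩ : ∃ t : ℝ, 0 < t ∧ e = t ^ 2 :=
    ⟨Real.sqrt e, Real.sqrt_pos.2 he, (Real.sq_sqrt he.le).symm⟩
  have h1 : (t ^ 2 : ℝ) ^ ((3 : ℝ) / 2) = t ^ 3 := by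
    rw [← Real.rpow_natCast, ← Real.rpow_natCast, ← Real.rpow_mul ht.le]; norm_num
  have h2 : ((t ^ 2) ^ 2 : ℝ) ^ ((5 : ℝ) / 2) = t ^ 10 := by
    rw [← pow_mul, ← Real.rpow_natCast, ← Real.rpow_natCast, ← Real.rpow_mul ht.le]; norm_num
  have h3 : Real.sqrt ((t ^ 2) ^ 2 * s / (t ^ 2 * n) ^ 3) = Real.sqrt (s / n ^ 3) / t := by
    rw [show (t ^ 2) ^ 2 * s / (t ^ 2 * n) ^ 3 = s / n ^ 3 / t ^ 2 by
      rw [mul_pow, ← pow_mul, ← pow_mul, div_div, mul_comm (n ^ 3)]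
      rw [show t ^ (2 * 3) * n ^ 3 = t ^ (2 * 2) * (t ^ 2 * n ^ 3) by ring]
      exact mul_div_mul_left _ _ (by positivity)]
    rw [Real.sqrt_div' _ (by positivity), Real.sqrt_sq ht.le]
  rw [Real.mul_rpow (by positivity) hn, Real.mul_rpow (by positivity) hx, h1, h2, h3]
  field_simp

lemma curvature_quotient_at_origin {β m : ℝ} (hβ : 0 < β) :
    (1 : ℝ) ^ ((3 : ℝ) / 2) * (β * (2 * m)) / β ^ ((5 : ℝ) / 2) /
      (2 * Real.sqrt (β / 1 ^ 3)) = m / β ^ 2 := by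
  obtain ⟨t, ht, rfl⟩ : ∃ t : ℝ, 0 < t ∧ β = t ^ 2 :=
    ⟨Real.sqrt β, Real.sqrt_pos.2 hβ, (Real.sq_sqrt hβ.le).symm⟩
  have h1 : (t ^ 2 : ℝ) ^ ((5 : ℝ) / 2) = t ^ 5 := by
    rw [← Real.rpow_natCast, ← Real.rpow_natCast, ← Real.rpow_mul ht.le]; norm_num
  rw [h1, Real.one_rpow, one_pow, div_one, Real.sqrt_sq ht.le]
  field_simp

end Algebra

/-- When cuspidal edges accumulate to a singular point of the second kind (strongly adapted
coordinates), the singular curvature `κ_s` is nonzero near the origin and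
`|κ_c(u)|/(2|κ_s(u)|^{1/2}) → |κ_H(p)| = |−⟨f_uv, ν_u⟩/‖f_uv‖²|` as `u → 0`. -/
theorem limit_cuspidal_over_sqrt_singular_curvature
    (f ν : ℝ × ℝ → E3) (ε : ℝ → ℝ)
    (hf : ContDiff ℝ (⊤ : ℕ∞) f) (hν : ContDiff ℝ (⊤ : ℕ∞) ν)
    (hfrontal : ∀ q : ℝ × ℝ, ‖ν q‖ = 1 ∧ ⟪ν q, pu f q⟫ = 0 ∧ ⟪ν q, pv f q⟫ = 0)
    (hε : ContDiff ℝ (⊤ : ℕ∞) ε) (hε0 : ε 0 = 0)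
    (hfu0 : pu f (0, 0) = 0) (hfv1 : ‖pv f (0, 0)‖ = 1)
    (hnull : ∀ᶠ u in nhds (0 : ℝ), pu f (u, 0) + ε u • pv f (u, 0) = 0)
    (hnd : LinearIndependent ℝ ![pv (pu f) (0, 0), pv f (0, 0)])
    (hperp : ⟪pv (pu f) (0, 0), pv f (0, 0)⟫ = 0)
    (hεne : ∀ᶠ u in nhdsWithin (0 : ℝ) {0}ᶜ, ε u ≠ 0) :
    let fη : ℝ × ℝ → E3 := fun q => pu f q + ε q.1 • pv f q
    let fηη : ℝ × ℝ → E3 := fun q => pu fη q + ε q.1 • pv fη q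
    let fηηη : ℝ × ℝ → E3 := fun q => pu fηη q + ε q.1 • pv fηη q
    let κs : ℝ → ℝ := fun u =>
      det3 (pu f (u, 0)) (pu (pu f) (u, 0)) (ν (u, 0)) / ‖pu f (u, 0)‖ ^ 3
    let κc : ℝ → ℝ := fun u =>
      ‖pu f (u, 0)‖ ^ ((3 : ℝ) / 2) *
          det3 (pu f (u, 0)) (fηη (u, 0)) (fηηη (u, 0)) /
        ‖cross3 (pu f (u, 0)) (fηη (u, 0))‖ ^ ((5 : ℝ) / 2)
    (∀ᶠ u in nhdsWithin (0 : ℝ) {0}ᶜ, κs u ≠ 0) ∧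
      Tendsto (fun u => |κc u| / (2 * Real.sqrt |κs u|)) (nhdsWithin 0 {0}ᶜ)
        (nhds |(-⟪pv (pu f) (0, 0), pu ν (0, 0)⟫) / ‖pv (pu f) (0, 0)‖ ^ 2|) := by
  intro fη fηη fηηη κs κc
  have hfη : ContDiff ℝ (⊤ : ℕ∞) fη := contDiff_null_deriv hf hε
  have hline : Continuous (fun u : ℝ => ((u, 0) : ℝ × ℝ)) := by fun_prop
  set A : ℝ → E3 := fun u => pv f (u, 0) with hA
  set B : ℝ → E3 := fun u => pu (pv f) (u, 0) with hB
  set W : ℝ → E3 := fun u => pv fη (u, 0) with hW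
  set Z : ℝ → E3 := fun u =>
    (2 : ℝ) • pu (pv fη) (u, 0) + ε u • pv (pv fη) (u, 0) with hZ
  set N : ℝ → E3 := fun u => ν (u, 0) with hN
  have cA : Continuous A := (contDiff_pv hf).continuous.comp hline
  have cB : Continuous B := (contDiff_pu (contDiff_pv hf)).continuous.comp hline
  have cW : Continuous W := (contDiff_pv hfη).continuous.comp hline
  have cN : Continuous N := hν.continuous.comp hline
  have cZ : Continuous Z :=
    (((contDiff_pu (contDiff_pv hfη)).continuous.comp hline).const_smul (2 : ℝ)).add
      (hε.continuous.smul ((contDiff_pv (contDiff_pv hfη)).continuous.comp hline))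
  -- values at the origin
  have hW0 : W 0 = pv (pu f) (0, 0) := by
    simp only [hW, fη]
    rw [pv_null_deriv hf hε, hε0, zero_smul, add_zero]
  have hB0 : B 0 = W 0 := by rw [hW0, pv_pu_comm hf]
  have hWne : W 0 ≠ 0 := by
    rw [hW0]; exact hnd.ne_zero 0
  have hAW : ⟪A 0, W 0⟫ = 0 := by rw [hW0, real_inner_comm]; exact hperp
  have hNA : ⟪N 0, A 0⟫ = 0 := (hfrontal (0, 0)).2.2
  have hN1 : ‖N 0‖ = 1 := (hfrontal (0, 0)).1
  have hNfη : ∀ q, ⟪ν q, fη q⟫ = 0 := fun q => by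
    simp only [fη, inner_add_right, inner_smul_right, (hfrontal q).2.1, (hfrontal q).2.2,
      mul_zero, add_zero]
  have hNW : ∀ᶠ u in nhds (0 : ℝ), ⟪N u, W u⟫ = 0 := by
    filter_upwards [hnull] with u hu
    have h := (hasDerivAt_pv_s15 hν u 0).inner ℝ (hasDerivAt_pv_s15 hfη u 0)
    have h' := h.unique ((hasDerivAt_const (0 : ℝ) (0 : ℝ)).congr_of_eventuallyEq
      (Eventually.of_forall fun t => hNfη (u, t)))
    have hu' : fη (u, 0) = 0 := hu
    rwa [hu', inner_zero_right, add_zero] at h'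
  have hNW0 : ⟪N 0, W 0⟫ = 0 := hNW.self_of_nhds
  have hNdW : ⟪N 0, pu (pv fη) (0, 0)⟫ = -⟪pv (pu f) (0, 0), pu ν (0, 0)⟫ := by
    have h := (hasDerivAt_pu_s15 hν 0 0).inner ℝ (hasDerivAt_pu_s15 (contDiff_pv hfη) 0 0)
    have h' := h.unique ((hasDerivAt_const (0 : ℝ) (0 : ℝ)).congr_of_eventuallyEq hNW)
    have h'' : ⟪N 0, pu (pv fη) (0, 0)⟫ + ⟪pu ν (0, 0), W 0⟫ = 0 := h'
    rw [hW0] at h''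
    rw [real_inner_comm (pu ν (0, 0))]
    linarith
  have hS0 : |det3 (A 0) (B 0) (N 0)| = ‖W 0‖ := by
    rw [hB0]; exact abs_det3_of_orthonormal hfv1 hN1 hAW hNA hNW0
  have hX0 : ‖cross3 (A 0) (W 0)‖ = ‖W 0‖ := norm_cross3_of_orthogonal hfv1 hAW
  have hC0 : |det3 (A 0) (W 0) (Z 0)| =
      ‖W 0‖ * (2 * |(-⟪pv (pu f) (0, 0), pu ν (0, 0)⟫)|) := by
    rw [abs_det3_of_orthogonal (Z 0) hfv1 hN1 hWne hAW hNA hNW0]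
    simp only [hZ, hε0, zero_smul, add_zero, inner_smul_right]
    rw [hNdW, abs_mul, abs_two]
  have hβ : 0 < ‖W 0‖ := norm_pos_iff.2 hWne
  have hA0 : A 0 ≠ 0 := by
    intro h; rw [← norm_eq_zero, hfv1] at h; exact one_ne_zero h
  have hS0ne : det3 (A 0) (B 0) (N 0) ≠ 0 := by
    rw [← abs_pos, hS0]; exact hβ
  have cS := continuous_det3 cA cB cN
  have cC := continuous_det3 cA cW cZ
  have cX := continuous_cross3 cA cW
  -- the derivatives along the `u`-axis
  have hu1 : ∀ᶠ u in nhds (0 : ℝ), pu f (u, 0) = -(ε u • A u) := by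
    filter_upwards [hnull] with u hu
    exact eq_neg_of_add_eq_zero_left hu
  have hu2 : ∀ᶠ u in nhds (0 : ℝ), pu (pu f) (u, 0) = -(deriv ε u • A u) - ε u • B u := by
    filter_upwards [eventually_eventually_nhds.2 hu1] with u hu
    have h := (((hε.differentiable (by simp) u).hasDerivAt).smul
      (hasDerivAt_pu_s15 (contDiff_pv hf) u 0)).neg
    rw [(hasDerivAt_pu_s15 (contDiff_pu hf) u 0).unique (h.congr_of_eventuallyEq hu)]
    simp only [hA, hB]
    abel
  have hη2 : ∀ᶠ u in nhds (0 : ℝ), fηη (u, 0) = ε u • W u := by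
    filter_upwards [eventually_eventually_nhds.2 hnull] with u hu
    exact null_deriv_null_deriv hfη hu
  have hη3 : ∀ᶠ u in nhds (0 : ℝ), fηηη (u, 0) = deriv ε u • W u + ε u • Z u := by
    filter_upwards [eventually_eventually_nhds.2 hnull] with u hu
    exact null_deriv_null_deriv_null_deriv hfη hε hu
  have hκs : ∀ᶠ u in nhds (0 : ℝ),
      κs u = ε u ^ 2 * det3 (A u) (B u) (N u) / (|ε u| * ‖A u‖) ^ 3 := by
    filter_upwards [hu1, hu2] with u h1 h2
    simp only [κs]
    rw [h1, h2, det3_first_derivs, norm_neg, norm_smul, Real.norm_eq_abs]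
  constructor
  · filter_upwards [hκs.filter_mono nhdsWithin_le_nhds, hεne,
      (cA.continuousAt.eventually_ne hA0).filter_mono nhdsWithin_le_nhds,
      (cS.continuousAt.eventually_ne hS0ne).filter_mono nhdsWithin_le_nhds] with u h1 h2 h3 h4
    rw [h1]
    exact div_ne_zero (mul_ne_zero (pow_ne_zero _ h2) h4)
      (pow_ne_zero _ (mul_ne_zero (abs_ne_zero.2 h2) (norm_ne_zero_iff.2 h3)))
  · set R : ℝ → ℝ := fun u =>
      ‖A u‖ ^ ((3 : ℝ) / 2) * |det3 (A u) (W u) (Z u)| / ‖cross3 (A u) (W u)‖ ^ ((5 : ℝ) / 2) /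
        (2 * Real.sqrt (|det3 (A u) (B u) (N u)| / ‖A u‖ ^ 3)) with hR
    have hAn : ‖A 0‖ = 1 := hfv1
    have hR0 : R 0 = |(-⟪pv (pu f) (0, 0), pu ν (0, 0)⟫) / ‖pv (pu f) (0, 0)‖ ^ 2| := by
      simp only [hR]
      rw [hAn, hC0, hX0, hS0, curvature_quotient_at_origin hβ, hW0, abs_div, abs_pow, abs_norm]
    have hRc : ContinuousAt R 0 := by
      refine ContinuousAt.div (ContinuousAt.div (ContinuousAt.mul ?_ cC.abs.continuousAt) ?_ ?_)
        (continuousAt_const.mul ?_) ?_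
      · exact cA.norm.continuousAt.rpow_const (Or.inr (by norm_num))
      · exact cX.norm.continuousAt.rpow_const (Or.inr (by norm_num))
      · rw [hX0]; exact (Real.rpow_pos_of_pos hβ _).ne'
      · refine Real.continuous_sqrt.continuousAt.comp
          (cS.abs.continuousAt.div (cA.norm.pow 3).continuousAt ?_)
        rw [hAn]; norm_num
      · rw [hAn, hS0]
        have : 0 < Real.sqrt (‖W 0‖ / 1 ^ 3) := Real.sqrt_pos.2 (by simpa using hβ)
        positivity
    rw [← hR0]
    refine (hRc.tendsto.mono_left nhdsWithin_le_nhds).congr' ?_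
    filter_upwards [hκs.filter_mono nhdsWithin_le_nhds, hu1.filter_mono nhdsWithin_le_nhds,
      hη2.filter_mono nhdsWithin_le_nhds, hη3.filter_mono nhdsWithin_le_nhds, hεne]
      with u h1 h2 h3 h4 h5
    have hs : |κs u| =
        |ε u| ^ 2 * |det3 (A u) (B u) (N u)| / (|ε u| * ‖A u‖) ^ 3 := by
      rw [h1, abs_div, abs_mul, abs_pow, abs_pow, abs_mul, abs_abs, abs_norm]
    have hc : |κc u| = (|ε u| * ‖A u‖) ^ ((3 : ℝ) / 2) *
        (|ε u| ^ 3 * |det3 (A u) (W u) (Z u)|) /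
          (|ε u| ^ 2 * ‖cross3 (A u) (W u)‖) ^ ((5 : ℝ) / 2) := by
      simp only [κc]
      rw [h2, h3, h4, det3_null_derivs, ← neg_smul, cross3_smul_smul, norm_smul, norm_smul,
        Real.norm_eq_abs, Real.norm_eq_abs, abs_mul (-ε u), abs_neg, ← sq, abs_div, abs_mul,
        abs_mul, abs_neg, abs_pow]
      rw [abs_of_nonneg (by positivity : 0 ≤ (|ε u| * ‖A u‖) ^ ((3 : ℝ) / 2)),
        abs_of_nonneg (by positivity :
          0 ≤ (|ε u| ^ 2 * ‖cross3 (A u) (W u)‖) ^ ((5 : ℝ) / 2))]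
    rw [hs, hc]
    exact (curvature_quotient_scaling (abs_pos.2 h5) (norm_nonneg _) (norm_nonneg _)).symm
end
end

section
/- Let f : ℝ² → ℝ⁴ be a C^∞ map near p with ‖f(q)‖ = 1 for all q (a surface in the unit sphere S³ ⊂ ℝ⁴), and let ν : ℝ² → ℝ⁴ be C^∞ with ‖ν(q)‖ = 1, ⟨ν(q), f(q)⟩ = 0, ⟨ν(q), f_u(q)⟩ = 0 and ⟨ν(q), f_v(q)⟩ = 0 for all q (ν is the Gauss map, the unit normal of f in S³ viewed in ℝ⁴). Suppose p is a rank-one singular point in admissible coordinates, i.e. f_v(p) = 0 and f_u(p) ≠ 0, and f is a front at p, i.e. ∂_v ν(p) ≠ 0. Then the Gauss map ν is singular at p (i.e. ∂_u ν(p) and ∂_v ν(p) are linearly dependent) if and only if the limiting normal curvature κ_ν(p) := ⟨f_uu(p), ν(p)⟩/‖f_u(p)‖² is equal to zero. -/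
open scoped RealInnerProductSpace
open Filter

noncomputable section

/-- Euclidean 4-space, the ambient space of the unit sphere `S³`. -/
abbrev E4 : Type := EuclideanSpace ℝ (Fin 4)

/-- A vector orthogonal to `finrank` many pairwise orthogonal nonzero vectors vanishes. -/
theorem eq_zero_of_inner_eq_zero_of_pairwise {E ι : Type*} [NormedAddCommGroup E]
    [InnerProductSpace ℝ E] [FiniteDimensional ℝ E] [Fintype ι] [Nonempty ι] {e : ι → E}
    (hcard : Fintype.card ι = Module.finrank ℝ E) (hne : ∀ i, e i ≠ 0)
    (ho : Pairwise fun i j => ⟪e i, e j⟫ = 0) {x : E} (hx : ∀ i, ⟪e i, x⟫ = 0) : x = 0 := by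
  have hli : LinearIndependent ℝ e := linearIndependent_of_ne_zero_of_inner_eq_zero hne ho
  have hspan := hli.span_eq_top_of_card_eq_finrank hcard
  refine ext_inner_left ℝ fun y => ?_
  rw [inner_zero_right]
  have hy : y ∈ Submodule.span ℝ (Set.range e) := hspan ▸ Submodule.mem_top
  induction hy using Submodule.span_induction with
  | mem z hz => obtain ⟨i, rfl⟩ := hz; exact hx i
  | zero => exact inner_zero_left _
  | add y z _ _ hy hz => rw [inner_add_left, hy, hz, add_zero]
  | smul c y _ hy => rw [real_inner_smul_left, hy, mul_zero]

/-- If `a, b, c, d` are nonzero and pairwise orthogonal in `ℝ⁴` and `w` is orthogonal to `a` and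
`b`, then `w` and `d` are linearly dependent iff `w` is orthogonal to `c`. -/
theorem not_linearIndependent_pair_iff_inner_eq_zero {a b c d w : E4}
    (ha : a ≠ 0) (hb : b ≠ 0) (hc : c ≠ 0) (hd : d ≠ 0)
    (hab : ⟪a, b⟫ = 0) (hac : ⟪a, c⟫ = 0) (had : ⟪a, d⟫ = 0)
    (hbc : ⟪b, c⟫ = 0) (hbd : ⟪b, d⟫ = 0) (hcd : ⟪c, d⟫ = 0)
    (haw : ⟪a, w⟫ = 0) (hbw : ⟪b, w⟫ = 0) :
    ¬ LinearIndependent ℝ ![w, d] ↔ ⟪c, w⟫ = 0 := by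
  rw [LinearIndependent.pair_symm_iff, LinearIndependent.pair_iff' hd]
  push Not
  constructor
  · rintro ⟨t, rfl⟩
    rw [real_inner_smul_right, hcd, mul_zero]
  · intro hcw
    have hdd : ⟪d, d⟫ ≠ 0 := inner_self_ne_zero.mpr hd
    refine ⟨⟪d, w⟫ / ⟪d, d⟫, (sub_eq_zero.mp ?_).symm⟩
    refine eq_zero_of_inner_eq_zero_of_pairwise (e := ![a, b, c, d]) (by simp) ?_ ?_ ?_
    · intro i
      fin_cases i <;> assumption
    · intro i j hij
      fin_cases i <;> fin_cases j <;>
        first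
        | exact absurd rfl hij
        | assumption
        | (rw [real_inner_comm]; assumption)
    · intro i
      rw [inner_sub_right, real_inner_smul_right]
      fin_cases i
      · simp [haw, had]
      · simp [hbw, hbd]
      · simp [hcw, hcd]
      · simp only [Fin.reduceFinMk, Matrix.cons_val]
        field_simp
        simp

/-- Leibniz rule for a locally constant inner product. -/
theorem inner_fderiv_add_eq_zero {V E : Type*} [NormedAddCommGroup V] [NormedSpace ℝ V]
    [NormedAddCommGroup E] [InnerProductSpace ℝ E] {g h : V → E} {p : V} {k : ℝ}
    (hg : DifferentiableAt ℝ g p) (hh : DifferentiableAt ℝ h p)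
    (hk : ∀ᶠ q in nhds p, ⟪g q, h q⟫ = k) (x : V) :
    ⟪g p, fderiv ℝ h p x⟫ + ⟪fderiv ℝ g p x, h p⟫ = 0 := by
  have hconst : (fun q => ⟪g q, h q⟫) =ᶠ[nhds p] fun _ => k := hk
  rw [← fderiv_inner_apply ℝ hg hh x, hconst.fderiv_eq]
  simp

/-- Mixed partial derivatives of a smooth map commute. -/
theorem pu_pv_eq_pv_pu {E : Type*} [NormedAddCommGroup E] [NormedSpace ℝ E] {f : ℝ × ℝ → E}
    (hf : ContDiff ℝ (⊤ : ℕ∞) f) (p : ℝ × ℝ) : pu (pv f) p = pv (pu f) p := by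
  have hd : DifferentiableAt ℝ (fderiv ℝ f) p :=
    (hf.fderiv_right (m := 1) (by norm_cast)).differentiable one_ne_zero p
  have hsymm : IsSymmSndFDerivAt ℝ f p :=
    hf.contDiffAt.isSymmSndFDerivAt (by simp; norm_cast)
  have h (x y : ℝ × ℝ) : fderiv ℝ (fun q => fderiv ℝ f q x) p y = fderiv ℝ (fderiv ℝ f) p y x := by
    rw [fderiv_clm_apply hd (differentiableAt_const x)]
    simp
  exact (h _ _).trans ((hsymm _ _).trans (h _ _).symm)

/-- For a front `f` in the unit sphere `S³ ⊂ ℝ⁴` with Gauss map `ν`, at a rank-one singular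
point `p` in admissible coordinates, the Gauss map `ν` is singular at `p` if and only if the
limiting normal curvature `κ_ν(p) = ⟨f_uu(p), ν(p)⟩/‖f_u(p)‖²` vanishes. -/
theorem gauss_map_singular_iff_limiting_normal_curvature_zero_S3
    (f ν : ℝ × ℝ → E4) (p : ℝ × ℝ)
    (hf : ContDiff ℝ (⊤ : ℕ∞) f) (hν : ContDiff ℝ (⊤ : ℕ∞) ν)
    (hsphere : ∀ᶠ q in nhds p,
      ‖f q‖ = 1 ∧ ‖ν q‖ = 1 ∧ ⟪ν q, f q⟫ = 0 ∧ ⟪ν q, pu f q⟫ = 0 ∧ ⟪ν q, pv f q⟫ = 0)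
    (hsing : pv f p = 0) (hrank1 : pu f p ≠ 0)
    (hfront : pv ν p ≠ 0) :
    (¬ LinearIndependent ℝ ![pu ν p, pv ν p]) ↔
      ⟪pu (pu f) p, ν p⟫ / ‖pu f p‖ ^ 2 = 0 := by
  have hf' (q) : DifferentiableAt ℝ f q := hf.differentiable (by simp) q
  have hν' : DifferentiableAt ℝ ν p := hν.differentiable (by simp) p
  have hdf : Differentiable ℝ (fderiv ℝ f) :=
    (hf.fderiv_right (m := 1) (by norm_cast)).differentiable one_ne_zero
  have hfu : DifferentiableAt ℝ (pu f) p := (hdf p).clm_apply (differentiableAt_const _)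
  have hfv : DifferentiableAt ℝ (pv f) p := (hdf p).clm_apply (differentiableAt_const _)
  have hff : ∀ᶠ q in nhds p, ⟪f q, f q⟫ = 1 :=
    hsphere.mono fun q h => by rw [real_inner_self_eq_norm_sq, h.1, one_pow]
  have hνν : ∀ᶠ q in nhds p, ⟪ν q, ν q⟫ = 1 :=
    hsphere.mono fun q h => by rw [real_inner_self_eq_norm_sq, h.2.1, one_pow]
  have hνf : ∀ᶠ q in nhds p, ⟪ν q, f q⟫ = 0 := hsphere.mono fun q h => h.2.2.1
  have hνfu : ∀ᶠ q in nhds p, ⟪ν q, pu f q⟫ = 0 := hsphere.mono fun q h => h.2.2.2.1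
  have hνfv : ∀ᶠ q in nhds p, ⟪ν q, pv f q⟫ = 0 := hsphere.mono fun q h => h.2.2.2.2
  obtain ⟨h1, h2, h3, h4, h5⟩ := hsphere.self_of_nhds
  have hf0 : f p ≠ 0 := norm_ne_zero_iff.mp (h1 ▸ one_ne_zero)
  have hν0 : ν p ≠ 0 := norm_ne_zero_iff.mp (h2 ▸ one_ne_zero)
  have f_fu : ⟪f p, pu f p⟫ + ⟪pu f p, f p⟫ = 0 :=
    inner_fderiv_add_eq_zero (hf' p) (hf' p) hff _
  have ν_νu : ⟪ν p, pu ν p⟫ + ⟪pu ν p, ν p⟫ = 0 := inner_fderiv_add_eq_zero hν' hν' hνν _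
  have ν_νv : ⟪ν p, pv ν p⟫ + ⟪pv ν p, ν p⟫ = 0 := inner_fderiv_add_eq_zero hν' hν' hνν _
  have f_νu : ⟪ν p, pu f p⟫ + ⟪pu ν p, f p⟫ = 0 := inner_fderiv_add_eq_zero hν' (hf' p) hνf _
  have f_νv : ⟪ν p, pv f p⟫ + ⟪pv ν p, f p⟫ = 0 := inner_fderiv_add_eq_zero hν' (hf' p) hνf _
  have fu_νu : ⟪ν p, pu (pu f) p⟫ + ⟪pu ν p, pu f p⟫ = 0 :=
    inner_fderiv_add_eq_zero hν' hfu hνfu _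
  have fu_νv : ⟪ν p, pv (pu f) p⟫ + ⟪pv ν p, pu f p⟫ = 0 :=
    inner_fderiv_add_eq_zero hν' hfu hνfu _
  have fv_νu : ⟪ν p, pu (pv f) p⟫ + ⟪pu ν p, pv f p⟫ = 0 :=
    inner_fderiv_add_eq_zero hν' hfv hνfv _
  rw [hsing, inner_zero_right, add_zero, pu_pv_eq_pv_pu hf] at fv_νu
  rw [real_inner_comm (f p) (pu f p)] at f_fu
  rw [real_inner_comm (ν p) (pu ν p)] at ν_νu
  rw [real_inner_comm (ν p) (pv ν p)] at ν_νv
  rw [real_inner_comm (f p) (pu ν p)] at f_νu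
  rw [real_inner_comm (f p) (pv ν p)] at f_νv
  rw [real_inner_comm (pu f p) (pu ν p)] at fu_νu
  rw [real_inner_comm (pu f p) (pv ν p)] at fu_νv
  rw [not_linearIndependent_pair_iff_inner_eq_zero hν0 hf0 hrank1 hfront h3 h4 (by linarith)
    (by linarith) (by linarith) (by linarith) (by linarith) (by linarith),
    div_eq_zero_iff, or_iff_left (pow_ne_zero 2 (norm_ne_zero_iff.mpr hrank1)),
    real_inner_comm (ν p)]
  constructor <;> intro h <;> linarith
end
end
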